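/- Let π be a permutation in the symmetric group S_p and let 𝔖_π(t,s) ∈ ℤ[t_1,…,t_p,s_1,…,s_p] be the corresponding double Schubert polynomial. Then the support supp(𝔖_π) ⊂ ℕ^{2p} is a discrete polymatroid on [2p] = {1,…,2p}. -/

import Mathlib

open MvPolynomial

/-- The Coxeter length of a permutation of `Fin p`, i.e. its number of inversions. -/
def permLength {p : ℕ} (π : Equiv.Perm (Fin p)) : ℕ :=
  (Finset.univ.filter (fun q : Fin p × Fin p => q.1 < q.2 ∧ π q.2 < π q.1)).card

/-- The defining recursion for the family of double Schubert polynomials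
`𝔖 : Equiv.Perm (Fin p) → ℤ[t₁,…,t_p,s₁,…,s_p]`, where the variable `X (Sum.inl i)`
plays the role of `t_{i+1}` and `X (Sum.inr j)` plays the role of `s_{j+1}`:
`𝔖 π₀ = ∏_{i+j ≤ p} (t_i - s_j)` for the longest permutation `π₀` (which is `Fin.revPerm`),
and `(t_i - t_{i+1}) ⬝ 𝔖 (𝔰_i π) = 𝔖 π - 𝔰_i ⬝ 𝔖 π` whenever `ℓ(𝔰_i π) < ℓ(π)`,
where the simple transposition `𝔰_i` acts on polynomials by permuting the `t`-variables. -/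
def IsDoubleSchubertFamily (p : ℕ)
    (𝔖 : Equiv.Perm (Fin p) → MvPolynomial (Fin p ⊕ Fin p) ℤ) : Prop :=
  (𝔖 Fin.revPerm =
      ∏ q ∈ Finset.univ.filter (fun q : Fin p × Fin p => (q.1 : ℕ) + (q.2 : ℕ) + 2 ≤ p),
        (X (Sum.inl q.1) - X (Sum.inr q.2))) ∧
  (∀ (π : Equiv.Perm (Fin p)) (i : Fin p) (h : (i : ℕ) + 1 < p),
    permLength (Equiv.swap i ⟨(i : ℕ) + 1, h⟩ * π) < permLength π →
      (X (Sum.inl i) - X (Sum.inl ⟨(i : ℕ) + 1, h⟩)) *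
          𝔖 (Equiv.swap i ⟨(i : ℕ) + 1, h⟩ * π)
        = 𝔖 π - MvPolynomial.rename (Sum.map (Equiv.swap i ⟨(i : ℕ) + 1, h⟩) id) (𝔖 π))

/-- A set `P ⊆ ℕ^σ` is a discrete polymatroid if it is the set of points
`x` with `∑_{j ∈ J} x j ≤ r J` for all proper subsets `J` and `∑ x = r univ`,
for some rank function `r` (normalized, monotone and submodular). -/
def IsDiscretePolymatroid {σ : Type*} [Fintype σ] [DecidableEq σ] (P : Set (σ → ℕ)) : Prop :=
  ∃ r : Finset σ → ℕ,
    r ∅ = 0 ∧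
    (∀ J₁ J₂ : Finset σ, J₁ ⊆ J₂ → r J₁ ≤ r J₂) ∧
    (∀ J₁ J₂ : Finset σ, r (J₁ ∩ J₂) + r (J₁ ∪ J₂) ≤ r J₁ + r J₂) ∧
    P = {x | (∀ J : Finset σ, J ⊂ Finset.univ → ∑ j ∈ J, x j ≤ r J) ∧
              ∑ i, x i = r Finset.univ}

/-- The action on polynomials of the transposition of two `t`-variables. -/
noncomputable def swapVars {n : ℕ} (a b : Fin n) :
    MvPolynomial (Fin n ⊕ Fin n) ℤ →ₐ[ℤ] MvPolynomial (Fin n ⊕ Fin n) ℤ :=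
  rename (Sum.map (Equiv.swap a b) id)

lemma swapVars_inl {n : ℕ} (a b i : Fin n) :
    swapVars a b (X (Sum.inl i)) = X (Sum.inl (Equiv.swap a b i)) := by simp [swapVars]

lemma swapVars_inr {n : ℕ} (a b j : Fin n) :
    swapVars a b (X (Sum.inr j)) = X (Sum.inr j) := by simp [swapVars]

lemma swapVars_swapVars {n : ℕ} (a b : Fin n) (f : MvPolynomial (Fin n ⊕ Fin n) ℤ) :
    swapVars a b (swapVars a b f) = f := by
  rw [swapVars, rename_rename]
  convert rename_id_apply f
  ext x
  rcases x with x | x <;> simp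

lemma X_inl_sub_X_inl_ne_zero {n : ℕ} {a b : Fin n} (hab : a ≠ b) :
    (X (Sum.inl a) - X (Sum.inl b) : MvPolynomial (Fin n ⊕ Fin n) ℤ) ≠ 0 := by
  rw [sub_ne_zero]
  intro h
  exact hab (Sum.inl_injective (X_injective h))

lemma X_inl_sub_X_inr_ne_zero {n : ℕ} (a b : Fin n) :
    (X (Sum.inl a) - X (Sum.inr b) : MvPolynomial (Fin n ⊕ Fin n) ℤ) ≠ 0 := by
  rw [sub_ne_zero]
  intro h
  exact absurd (X_injective h) (by simp)

lemma permLength_swap_mul_lt {n : ℕ} (w : Equiv.Perm (Fin n)) {a b : Fin n}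
    (hab : (b : ℕ) = a + 1) (h : w b < w a) :
    permLength (Equiv.swap a b * w⁻¹) < permLength w⁻¹ := by
  have hlt : a < b := by rw [Fin.lt_def]; omega
  unfold permLength
  apply Finset.card_lt_card
  constructor
  · rintro ⟨x, y⟩ hq
    rw [Finset.mem_filter] at hq ⊢
    obtain ⟨u, rfl⟩ := w.surjective x
    obtain ⟨v, rfl⟩ := w.surjective y
    simp only [Finset.mem_univ, true_and, Equiv.Perm.mul_apply, Equiv.Perm.coe_inv,
      Equiv.symm_apply_apply] at hq ⊢
    obtain ⟨h1, h2⟩ := hq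
    refine ⟨h1, ?_⟩
    by_contra h3
    rw [Equiv.swap_apply_def, Equiv.swap_apply_def] at h2
    split_ifs at h2 <;> subst_vars <;> simp only [Fin.lt_def, Fin.ext_iff] at * <;> omega
  · intro hs
    have := @hs (w b, w a)
    rw [Finset.mem_filter, Finset.mem_filter] at this
    simp only [Finset.mem_univ, true_and, Equiv.Perm.mul_apply, Equiv.Perm.coe_inv,
      Equiv.symm_apply_apply, Equiv.swap_apply_left, Equiv.swap_apply_right] at this
    exact absurd (this ⟨h, hlt⟩).2 (not_lt.2 hlt.le)

/-- The double Schubert recursion in terms of the right weak order. -/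
structure IsSchubertFamily {n : ℕ}
    (S : Equiv.Perm (Fin n) → MvPolynomial (Fin n ⊕ Fin n) ℤ) : Prop where
  rev : S Fin.revPerm =
      ∏ q ∈ Finset.univ.filter (fun q : Fin n × Fin n => (q.1 : ℕ) + (q.2 : ℕ) + 2 ≤ n),
        (X (Sum.inl q.1) - X (Sum.inr q.2))
  desc : ∀ (w : Equiv.Perm (Fin n)) (a b : Fin n), (b : ℕ) = a + 1 → w b < w a →
    (X (Sum.inl a) - X (Sum.inl b)) * S (w * Equiv.swap a b) = S w - swapVars a b (S w)

lemma IsDoubleSchubertFamily.isSchubertFamily {n : ℕ}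
    {S : Equiv.Perm (Fin n) → MvPolynomial (Fin n ⊕ Fin n) ℤ}
    (hS : IsDoubleSchubertFamily n S) : IsSchubertFamily (fun w => S w⁻¹) := by
  refine ⟨?_, ?_⟩
  · have : (Fin.revPerm : Equiv.Perm (Fin n))⁻¹ = Fin.revPerm := Equiv.ext fun x => rfl
    simpa [this] using hS.1
  · intro w a b hab h
    have hb : (a : ℕ) + 1 < n := hab ▸ b.2
    obtain rfl : b = ⟨(a : ℕ) + 1, hb⟩ := Fin.ext hab
    have := hS.2 w⁻¹ a hb (permLength_swap_mul_lt w rfl h)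
    simpa [swapVars] using this

lemma IsSchubertFamily.swapVars_eq {n : ℕ}
    {S : Equiv.Perm (Fin n) → MvPolynomial (Fin n ⊕ Fin n) ℤ} (hS : IsSchubertFamily S)
    (w : Equiv.Perm (Fin n)) {a b : Fin n} (hab : (b : ℕ) = a + 1) (h : w a < w b) :
    swapVars a b (S w) = S w := by
  have hne : a ≠ b := fun e => by rw [e] at hab; omega
  have h1 := hS.desc (w * Equiv.swap a b) a b hab (by simpa using h)
  rw [Equiv.mul_swap_mul_self] at h1
  have h2 := congrArg (swapVars a b) h1
  simp only [map_mul, map_sub, swapVars_inl, swapVars_swapVars, Equiv.swap_apply_left,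
    Equiv.swap_apply_right] at h2
  apply mul_left_cancel₀ (X_inl_sub_X_inl_ne_zero hne)
  linear_combination -h2 - h1

/-- The position of the first entry where `w` differs from the longest permutation. -/
def IsFirstDefect {n : ℕ} (w : Equiv.Perm (Fin n)) (i : Fin n) : Prop :=
  (∀ a < i, w a = Fin.rev a) ∧ w i < Fin.rev i

lemma exists_isFirstDefect {n : ℕ} {w : Equiv.Perm (Fin n)} (hw : w ≠ Fin.revPerm) :
    ∃ i, IsFirstDefect w i := by
  have h : ∃ i, w i ≠ Fin.rev i := by
    by_contra! h
    exact hw (Equiv.ext h)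
  classical
  obtain ⟨i, hi, hmin⟩ := (Finset.univ.filter (fun i => w i ≠ Fin.rev i)).exists_minimal
    (by obtain ⟨i, hi⟩ := h; exact ⟨i, by simpa using hi⟩)
  simp only [Finset.mem_filter, Finset.mem_univ, true_and] at hi hmin
  have hlow : ∀ a < i, w a = Fin.rev a := fun a ha => by
    by_contra hc
    exact absurd (hmin hc ha.le) (not_le.2 ha)
  refine ⟨i, hlow, lt_of_le_of_ne ?_ hi⟩
  by_contra hc
  rw [not_le, Fin.rev_lt_iff] at hc
  have := hlow _ hc
  rw [Fin.rev_rev] at this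
  exact absurd (w.injective this) hc.ne

/-- A measure of permutations that decreases when ascents are exchanged. -/
def permWeight {n : ℕ} (w : Equiv.Perm (Fin n)) : ℕ := ∑ a : Fin n, (a : ℕ) * (w a : ℕ)

lemma permWeight_mul_swap_lt {n : ℕ} {w : Equiv.Perm (Fin n)} {a b : Fin n} (hab : a < b)
    (h : w a < w b) : permWeight (w * Equiv.swap a b) < permWeight w := by
  unfold permWeight
  have hb : b ∈ Finset.univ.erase a := by simp [hab.ne']
  rw [← Finset.add_sum_erase _ _ (Finset.mem_univ a), ← Finset.add_sum_erase _ _ hb,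
    ← Finset.add_sum_erase (Finset.univ : Finset (Fin n)) (fun a => (a : ℕ) * (w a : ℕ))
      (Finset.mem_univ a), ← Finset.add_sum_erase _ _ hb]
  have : ∑ x ∈ (Finset.univ.erase a).erase b, (x : ℕ) * ((w * Equiv.swap a b) x : ℕ) =
      ∑ x ∈ (Finset.univ.erase a).erase b, (x : ℕ) * (w x : ℕ) := by
    apply Finset.sum_congr rfl
    intro x hx
    simp only [Finset.mem_erase] at hx
    rw [Equiv.Perm.mul_apply, Equiv.swap_apply_of_ne_of_ne hx.2.1 hx.1]
  rw [this]
  simp only [Equiv.Perm.mul_apply, Equiv.swap_apply_left, Equiv.swap_apply_right]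
  rw [Fin.lt_def] at hab h
  nlinarith

/-- The positions `l` such that `w * swap i l` covers `w` with `i < l`. -/
def coverPositions {n : ℕ} (w : Equiv.Perm (Fin n)) (i : Fin n) : Finset (Fin n) :=
  Finset.univ.filter (fun l => i < l ∧ w i < w l ∧ ∀ a, i < a → a < l → ¬ (w i < w a ∧ w a < w l))

lemma mem_coverPositions {n : ℕ} {w : Equiv.Perm (Fin n)} {i l : Fin n} :
    l ∈ coverPositions w i ↔
      i < l ∧ w i < w l ∧ ∀ a, i < a → a < l → ¬ (w i < w a ∧ w a < w l) := by
  simp [coverPositions]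

section Cotransition

lemma mem_coverPositions_mul_swap_iff {n : ℕ} {w : Equiv.Perm (Fin n)} {i a b l : Fin n}
    (hab : (b : ℕ) = a + 1) (hia : i < a) (h : w a < w b) :
    (l ∈ coverPositions (w * Equiv.swap a b) i ∧
      (w * Equiv.swap a b * Equiv.swap i l) b < (w * Equiv.swap a b * Equiv.swap i l) a) ↔
    Equiv.swap a b l ∈ coverPositions w i := by
  have hlt : a < b := by rw [Fin.lt_def]; omega
  have hib : i < b := hia.trans hlt
  have hi : Equiv.swap a b i = i := Equiv.swap_apply_of_ne_of_ne hia.ne hib.ne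
  have key : ∀ x, x ≠ a → x ≠ b → (x < a ∨ b < x) := fun x h1 h2 => by
    rw [Fin.lt_def, Fin.lt_def]; rw [Ne, Fin.ext_iff] at h1 h2; omega
  have hbt : ∀ x, a < x → x < b → False := fun x h1 h2 => by
    rw [Fin.lt_def] at h1 h2; omega
  simp only [mem_coverPositions, Equiv.Perm.mul_apply, hi]
  by_cases hla : l = a
  · subst hla
    simp only [Equiv.swap_apply_left, Equiv.swap_apply_right,
      Equiv.swap_apply_of_ne_of_ne hib.ne' hlt.ne', hi]
    constructor
    · rintro ⟨⟨-, h2, h3⟩, h4⟩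
      refine ⟨hib, h2, fun x hx1 hx2 => ?_⟩
      by_cases hxl : x = l
      · subst hxl; exact fun hh => absurd hh.1 (not_lt.2 h4.le)
      · have hx : x < l := (key x hxl hx2.ne).resolve_right (not_lt.2 hx2.le)
        have := h3 x hx1 hx
        rwa [Equiv.swap_apply_of_ne_of_ne hxl hx2.ne] at this
    · rintro ⟨-, h2, h3⟩
      refine ⟨⟨hia, h2, fun x hx1 hx2 => ?_⟩, ?_⟩
      · rw [Equiv.swap_apply_of_ne_of_ne hx2.ne (hx2.trans hlt).ne]
        exact h3 x hx1 (hx2.trans hlt)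
      · have := h3 l hia hlt
        rcases lt_trichotomy (w l) (w i) with h5 | h5 | h5
        · exact h5
        · exact absurd (w.injective h5) hia.ne'
        · exact absurd ⟨h5, h⟩ this
  by_cases hlb : l = b
  · subst hlb
    simp only [Equiv.swap_apply_right, Equiv.swap_apply_of_ne_of_ne hia.ne' hlt.ne,
      Equiv.swap_apply_left, hi]
    constructor
    · rintro ⟨⟨-, h2, h3⟩, h4⟩
      refine ⟨hia, h2, fun x hx1 hx2 => ?_⟩
      have := h3 x hx1 (hx2.trans hlt)
      rwa [Equiv.swap_apply_of_ne_of_ne hx2.ne (hx2.trans hlt).ne] at this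
    · rintro ⟨-, h2, h3⟩
      refine ⟨⟨hib, h2, fun x hx1 hx2 => ?_⟩, h2.trans h⟩
      by_cases hxl : x = a
      · subst hxl
        rw [Equiv.swap_apply_left]
        exact fun hh => absurd hh.2 (not_lt.2 h.le)
      · rw [Equiv.swap_apply_of_ne_of_ne hxl hx2.ne]
        exact h3 x hx1 ((key x hxl hx2.ne).resolve_right (not_lt.2 hx2.le))
  · have hl : Equiv.swap a b l = l := Equiv.swap_apply_of_ne_of_ne hla hlb
    rw [hl]
    by_cases hil : i < l
    · rw [Equiv.swap_apply_of_ne_of_ne hia.ne' (Ne.symm hla),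
        Equiv.swap_apply_of_ne_of_ne hib.ne' (Ne.symm hlb), Equiv.swap_apply_left,
        Equiv.swap_apply_right]
      simp only [h, and_true]
      refine and_congr_right fun _ => and_congr_right fun _ => ?_
      have hsw : ∀ x, i < x → x < l → i < Equiv.swap a b x ∧ Equiv.swap a b x < l := by
        intro x h1 h2
        rw [Equiv.swap_apply_def]
        have := key l hla hlb
        split_ifs with c1 c2
        · subst c1
          exact ⟨hib, this.resolve_left (not_lt.2 h2.le)⟩
        · subst c2
          exact ⟨hia, hlt.trans h2⟩
        · exact ⟨h1, h2⟩
      constructor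
      · intro h3 x h1 h2
        have := h3 _ (hsw x h1 h2).1 (hsw x h1 h2).2
        rwa [Equiv.swap_apply_self] at this
      · intro h3 x h1 h2
        exact h3 _ (hsw x h1 h2).1 (hsw x h1 h2).2
    · simp [hil]

lemma mul_swap_mul_swap_mul_swap {n : ℕ} (w : Equiv.Perm (Fin n)) {i a b l : Fin n}
    (hia : i ≠ a) (hib : i ≠ b) :
    w * Equiv.swap a b * Equiv.swap i l * Equiv.swap a b = w * Equiv.swap i (Equiv.swap a b l) := by
  have := Equiv.swap_apply_apply (Equiv.swap a b) i l
  rw [Equiv.swap_apply_of_ne_of_ne hia hib] at this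
  rw [this, Equiv.swap_inv, mul_assoc, mul_assoc, mul_assoc]

variable {n : ℕ} {S : Equiv.Perm (Fin n) → MvPolynomial (Fin n ⊕ Fin n) ℤ}

lemma IsSchubertFamily.sub_swapVars (hS : IsSchubertFamily S) (w : Equiv.Perm (Fin n))
    {a b : Fin n} (hab : (b : ℕ) = a + 1) :
    S w - swapVars a b (S w) = if w b < w a then
      (X (Sum.inl a) - X (Sum.inl b)) * S (w * Equiv.swap a b) else 0 := by
  split_ifs with h
  · exact (hS.desc w a b hab h).symm
  · have hne : a ≠ b := fun e => by rw [e] at hab; omega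
    rw [hS.swapVars_eq w hab (lt_of_le_of_ne (not_lt.1 h) (w.injective.ne hne)), sub_self]

/-- The cotransition formula propagates along ascents to the right of the defect. -/
lemma IsSchubertFamily.cotransition_of_ascent (hS : IsSchubertFamily S)
    {w : Equiv.Perm (Fin n)} {i a b : Fin n} (hab : (b : ℕ) = a + 1) (hia : i < a) (h : w a < w b)
    (IH : (X (Sum.inl i) - X (Sum.inr (w i))) * S (w * Equiv.swap a b) =
      ∑ l ∈ coverPositions (w * Equiv.swap a b) i, S (w * Equiv.swap a b * Equiv.swap i l)) :
    (X (Sum.inl i) - X (Sum.inr (w i))) * S w =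
      ∑ l ∈ coverPositions w i, S (w * Equiv.swap i l) := by
  have hlt : a < b := by rw [Fin.lt_def]; omega
  have hib : i < b := hia.trans hlt
  have hd := hS.desc (w * Equiv.swap a b) a b hab (by simpa using h)
  rw [Equiv.mul_swap_mul_self] at hd
  have IH2 := congrArg (swapVars a b) IH
  simp only [map_mul, map_sub, swapVars_inl, swapVars_inr, map_sum,
    Equiv.swap_apply_of_ne_of_ne hia.ne hib.ne] at IH2
  have e : (X (Sum.inl a) - X (Sum.inl b)) * ((X (Sum.inl i) - X (Sum.inr (w i))) * S w) =
      ∑ l ∈ coverPositions (w * Equiv.swap a b) i,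
        (S (w * Equiv.swap a b * Equiv.swap i l) -
          swapVars a b (S (w * Equiv.swap a b * Equiv.swap i l))) := by
    rw [Finset.sum_sub_distrib, ← IH, ← IH2]
    linear_combination (X (Sum.inl i) - X (Sum.inr (w i))) * hd
  apply mul_left_cancel₀ (X_inl_sub_X_inl_ne_zero hlt.ne)
  rw [e]
  simp only [hS.sub_swapVars _ hab, mul_swap_mul_swap_mul_swap w hia.ne hib.ne]
  rw [← Finset.sum_filter, ← Finset.mul_sum]
  congr 1
  refine Finset.sum_bij' (fun l _ => Equiv.swap a b l) (fun l _ => Equiv.swap a b l) ?_ ?_ ?_ ?_ ?_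
  · intro l hl
    exact (mem_coverPositions_mul_swap_iff hab hia h).1 (Finset.mem_filter.1 hl)
  · intro l hl
    rw [Finset.mem_filter, mem_coverPositions_mul_swap_iff hab hia h, Equiv.swap_apply_self]
    exact hl
  · simp
  · simp
  · simp

lemma apply_le_rev {w : Equiv.Perm (Fin n)} {i l : Fin n} (h : ∀ a < i, w a = Fin.rev a)
    (hl : i ≤ l) : w l ≤ Fin.rev i := by
  by_contra hc
  rw [not_le, Fin.rev_lt_iff] at hc
  have h1 := h _ hc
  rw [Fin.rev_rev] at h1
  rw [w.injective h1] at hc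
  exact absurd hc (not_lt.2 hl)

lemma IsFirstDefect.exists_next {w : Equiv.Perm (Fin n)} {i : Fin n} (h : IsFirstDefect w i)
    (hanti : ∀ a b, i < a → a < b → w b < w a) :
    ∃ b : Fin n, (b : ℕ) = i + 1 ∧ w b = Fin.rev i := by
  obtain ⟨k, hk⟩ := w.surjective (Fin.rev i)
  have hik : i < k := by
    rcases lt_trichotomy i k with h1 | h1 | h1
    · exact h1
    · subst h1; exact absurd hk h.2.ne
    · have := h.1 k h1
      rw [hk] at this
      exact absurd (Fin.rev_injective this) h1.ne'
  have hb : (i : ℕ) + 1 < n := by have := k.2; rw [Fin.lt_def] at hik; omega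
  refine ⟨⟨i + 1, hb⟩, rfl, ?_⟩
  have hib : i < (⟨i + 1, hb⟩ : Fin n) := by simp [Fin.lt_def]
  rcases lt_trichotomy (⟨i + 1, hb⟩ : Fin n) k with h1 | h1 | h1
  · have := hanti _ _ hib h1
    rw [hk] at this
    exact absurd (apply_le_rev h.1 hib.le) (not_le.2 this)
  · rw [h1, hk]
  · rw [Fin.lt_def] at h1 hik
    simp only at h1
    omega

lemma eq_revPerm_of_anti {w : Equiv.Perm (Fin n)} {b : Fin n} (hlow : ∀ a ≤ b, w a = Fin.rev a)
    (hanti : ∀ x y, b < x → x < y → w y < w x) : w = Fin.revPerm := by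
  by_contra hne
  obtain ⟨m, hm⟩ := exists_isFirstDefect hne
  have hbm : b < m := by
    by_contra hc
    exact hm.2.ne (hlow m (not_lt.1 hc))
  obtain ⟨c, hc1, hc2⟩ := hm.exists_next (fun x y hx hy => hanti x y (hbm.trans hx) hy)
  have hmc : m < c := by rw [Fin.lt_def]; omega
  have := hanti m c hbm hmc
  rw [hc2] at this
  exact absurd hm.2 (not_lt.2 this.le)

lemma IsSchubertFamily.swap_revPerm (hS : IsSchubertFamily S) {i b j : Fin n}
    (hib : (b : ℕ) = i + 1) (hj : j = Fin.rev b) :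
    (X (Sum.inl i) - X (Sum.inr j)) * S (Fin.revPerm * Equiv.swap i b) = S Fin.revPerm := by
  have hlt : i < b := by rw [Fin.lt_def]; omega
  have hjn : (j : ℕ) = n - 1 - b := by rw [hj, Fin.val_rev]; omega
  have hd := hS.desc Fin.revPerm i b hib (by simpa [Fin.rev_lt_rev] using hlt)
  set Q := Finset.univ.filter (fun q : Fin n × Fin n => (q.1 : ℕ) + (q.2 : ℕ) + 2 ≤ n) with hQ
  have hbn := b.2
  have hmem : (i, j) ∈ Q := by simp only [hQ, Finset.mem_filter, Finset.mem_univ, true_and]; omega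
  set R : MvPolynomial (Fin n ⊕ Fin n) ℤ :=
    ∏ q ∈ Q.erase (i, j), (X (Sum.inl q.1) - X (Sum.inr q.2)) with hR
  have hfac : S Fin.revPerm = (X (Sum.inl i) - X (Sum.inr j)) * R := by
    rw [hS.rev, ← hQ, ← Finset.mul_prod_erase Q _ hmem]
  have hsym : swapVars i b R = R := by
    rw [hR, map_prod]
    refine Finset.prod_bij' (fun q _ => (Equiv.swap i b q.1, q.2))
      (fun q _ => (Equiv.swap i b q.1, q.2)) ?_ ?_ ?_ ?_ ?_
    rotate_left 2
    all_goals try (rintro ⟨x, y⟩ hq; simp [swapVars_inl, swapVars_inr]; done)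
    all_goals
      rintro ⟨x, y⟩ hq
      simp only [hQ, Finset.mem_erase, Finset.mem_filter, Finset.mem_univ, true_and, ne_eq,
        Prod.mk.injEq, Fin.ext_iff, not_and] at hq ⊢
      rw [Equiv.swap_apply_def]
      split_ifs with c1 c2
      · subst c1; omega
      · subst c2; omega
      · rw [Fin.ext_iff] at c1 c2; omega
  have hR2 : S (Fin.revPerm * Equiv.swap i b) = R := by
    apply mul_left_cancel₀ (X_inl_sub_X_inl_ne_zero hlt.ne)
    rw [hd, hfac, map_mul, hsym, map_sub, swapVars_inl, swapVars_inr, Equiv.swap_apply_left]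
    ring
  rw [hR2, hfac]

/-- The cotransition formula when all the entries to the right of the defect decrease. -/
lemma IsSchubertFamily.cotransition_of_anti (hS : IsSchubertFamily S)
    {w : Equiv.Perm (Fin n)} {i : Fin n} (hi : IsFirstDefect w i)
    (hanti : ∀ a b, i < a → a < b → w b < w a)
    (IH : ∀ b : Fin n, (b : ℕ) = i + 1 → IsFirstDefect (w * Equiv.swap i b) b →
      (X (Sum.inl b) - X (Sum.inr (w i))) * S (w * Equiv.swap i b) =
      ∑ l ∈ coverPositions (w * Equiv.swap i b) b, S (w * Equiv.swap i b * Equiv.swap b l)) :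
    (X (Sum.inl i) - X (Sum.inr (w i))) * S w =
      ∑ l ∈ coverPositions w i, S (w * Equiv.swap i l) := by
  obtain ⟨b, hib, hwb⟩ := hi.exists_next hanti
  have hlt : i < b := by rw [Fin.lt_def]; omega
  have hasc : w i < w b := by rw [hwb]; exact hi.2
  have hd := hS.desc (w * Equiv.swap i b) i b hib (by simpa using hasc)
  rw [Equiv.mul_swap_mul_self] at hd
  have hlow : ∀ a < b, (w * Equiv.swap i b) a = Fin.rev a := by
    intro a ha
    rw [Equiv.Perm.mul_apply]
    by_cases hai : a = i
    · rw [hai, Equiv.swap_apply_left, hwb]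
    · rw [Equiv.swap_apply_of_ne_of_ne hai ha.ne]
      apply hi.1
      rw [Fin.lt_def] at *
      rw [Fin.ext_iff] at hai
      omega
  have hhigh : ∀ l, b < l → (w * Equiv.swap i b) l = w l := by
    intro l hl
    rw [Equiv.Perm.mul_apply, Equiv.swap_apply_of_ne_of_ne (hlt.trans hl).ne' hl.ne']
  have hwb' : (w * Equiv.swap i b) b = w i := by simp
  have hle : w i ≤ Fin.rev b := by
    have := hi.2
    rw [Fin.lt_def, Fin.val_rev] at this
    rw [Fin.le_def, Fin.val_rev]
    omega
  have hbl : ∀ l, b < l → w l < w b := fun l hl => hanti b l hlt hl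
  rcases hle.lt_or_eq with hlt' | heq
  · have IH := IH b hib ⟨hlow, by rwa [hwb']⟩
    have IH2 := congrArg (swapVars i b) IH
    simp only [map_mul, map_sub, swapVars_inl, swapVars_inr, map_sum,
      Equiv.swap_apply_right] at IH2
    have hcov : coverPositions w i = insert b (coverPositions (w * Equiv.swap i b) b) := by
      ext l
      rw [Finset.mem_insert, mem_coverPositions, mem_coverPositions, hwb']
      constructor
      · rintro ⟨h1, h2, h3⟩
        by_cases hlb : l = b
        · exact Or.inl hlb
        · have hbl' : b < l := by
            rw [Fin.lt_def] at *; rw [Fin.ext_iff] at hlb; omega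
          refine Or.inr ⟨hbl', by rwa [hhigh l hbl'], fun a ha1 ha2 => ?_⟩
          rw [hhigh l hbl', hhigh a ha1]
          exact h3 a (hlt.trans ha1) ha2
      · rintro (rfl | ⟨h1, h2, h3⟩)
        · refine ⟨hlt, hasc, fun a ha1 ha2 => ?_⟩
          rw [Fin.lt_def] at ha1 ha2; omega
        · rw [hhigh l h1] at h2 h3
          refine ⟨hlt.trans h1, h2, fun a ha1 ha2 => ?_⟩
          by_cases hab : a = b
          · subst hab
            exact fun hh => absurd hh.2 (not_lt.2 (hbl l h1).le)
          · have hba : b < a := by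
              rw [Fin.lt_def] at *; rw [Fin.ext_iff] at hab; omega
            have := h3 a hba ha2
            rwa [hhigh a hba] at this
    have hnot : b ∉ coverPositions (w * Equiv.swap i b) b := by simp [mem_coverPositions]
    rw [hcov, Finset.sum_insert hnot]
    apply mul_left_cancel₀ (X_inl_sub_X_inl_ne_zero hlt.ne)
    have e : ∑ l ∈ coverPositions (w * Equiv.swap i b) b,
        (S (w * Equiv.swap i b * Equiv.swap b l) -
          swapVars i b (S (w * Equiv.swap i b * Equiv.swap b l))) =
        (X (Sum.inl i) - X (Sum.inl b)) * ∑ l ∈ coverPositions (w * Equiv.swap i b) b,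
          S (w * Equiv.swap i l) := by
      rw [Finset.mul_sum]
      refine Finset.sum_congr rfl fun l hl => ?_
      rw [mem_coverPositions] at hl
      have h1 : w * Equiv.swap i b * Equiv.swap b l * Equiv.swap i b = w * Equiv.swap i l := by
        have := Equiv.swap_apply_apply (Equiv.swap i b) b l
        rw [Equiv.swap_apply_right, Equiv.swap_apply_of_ne_of_ne (hlt.trans hl.1).ne' hl.1.ne',
          Equiv.swap_inv] at this
        rw [this, mul_assoc, mul_assoc, mul_assoc]
      rw [hS.sub_swapVars _ hib, h1, if_pos]
      simp only [Equiv.Perm.mul_apply, Equiv.swap_apply_left,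
        Equiv.swap_apply_of_ne_of_ne (hlt.trans hl.1).ne' hl.1.ne',
        Equiv.swap_apply_of_ne_of_ne hlt.ne (hlt.trans hl.1).ne]
      exact hbl l hl.1
    rw [Finset.sum_sub_distrib, ← IH, ← IH2] at e
    rw [mul_add, ← e]
    linear_combination (X (Sum.inl i) - X (Sum.inr (w i))) * hd
  · have hrev : w * Equiv.swap i b = Fin.revPerm := by
      refine eq_revPerm_of_anti (b := b) (fun a ha => ?_) (fun x y hx hy => ?_)
      · rcases ha.lt_or_eq with h1 | h1
        · exact hlow a h1
        · rw [h1, hwb', heq]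
      · rw [hhigh x hx, hhigh y (hx.trans hy)]
        exact hanti x y (hlt.trans hx) hy
    have hw : w = Fin.revPerm * Equiv.swap i b := by rw [← hrev, Equiv.mul_swap_mul_self]
    have hcov : coverPositions w i = {b} := by
      ext l
      rw [Finset.mem_singleton, mem_coverPositions]
      constructor
      · rintro ⟨h1, h2, -⟩
        by_contra hlb
        have hbl' : b < l := by
          rw [Fin.lt_def] at *; rw [Fin.ext_iff] at hlb; omega
        have h3 := hhigh l hbl'
        rw [hrev, Fin.revPerm_apply] at h3
        rw [← h3, heq, Fin.rev_lt_rev] at h2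
        exact absurd h2 (not_lt.2 hbl'.le)
      · rintro rfl
        refine ⟨hlt, hasc, fun a ha1 ha2 => ?_⟩
        rw [Fin.lt_def] at ha1 ha2; omega
    rw [hcov, Finset.sum_singleton, hrev, ← hS.swap_revPerm hib heq, ← hw]

/-- The cotransition formula for double Schubert polynomials. -/
theorem IsSchubertFamily.cotransition (hS : IsSchubertFamily S) {w : Equiv.Perm (Fin n)}
    {i : Fin n} (hi : IsFirstDefect w i) :
    (X (Sum.inl i) - X (Sum.inr (w i))) * S w =
      ∑ l ∈ coverPositions w i, S (w * Equiv.swap i l) := by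
  induction hm : permWeight w using Nat.strong_induction_on generalizing w i with
  | _ m IH =>
    subst hm
    by_cases hasc : ∃ a b : Fin n, (b : ℕ) = a + 1 ∧ i < a ∧ w a < w b
    · obtain ⟨a, b, hab, hia, h⟩ := hasc
      have hlt : a < b := by rw [Fin.lt_def]; omega
      have hwi : (w * Equiv.swap a b) i = w i := by
        rw [Equiv.Perm.mul_apply, Equiv.swap_apply_of_ne_of_ne hia.ne (hia.trans hlt).ne]
      apply hS.cotransition_of_ascent hab hia h
      rw [← hwi]
      refine IH _ (permWeight_mul_swap_lt hlt h) ⟨fun x hx => ?_, ?_⟩ rfl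
      · rw [Equiv.Perm.mul_apply, Equiv.swap_apply_of_ne_of_ne (hx.trans hia).ne
          (hx.trans (hia.trans hlt)).ne]
        exact hi.1 x hx
      · rw [hwi]; exact hi.2
    · push Not at hasc
      have hanti : ∀ a b, i < a → a < b → w b < w a := by
        intro a b hia hab
        have : ∀ k : ℕ, ∀ b : Fin n, (b : ℕ) = a + 1 + k → w b < w a := by
          intro k
          induction k with
          | zero =>
            intro b hb
            refine lt_of_le_of_ne (hasc a b (by omega) hia) (w.injective.ne ?_)
            intro e; rw [e] at hb; omega
          | succ k ih =>
            intro b hb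
            have hc : (a : ℕ) + 1 + k < n := by have := b.2; omega
            refine lt_of_le_of_lt (hasc ⟨a + 1 + k, hc⟩ b (by simp; omega) ?_)
              (ih ⟨a + 1 + k, hc⟩ rfl)
            rw [Fin.lt_def] at *; simp only; omega
        exact this (b - a - 1) b (by rw [Fin.lt_def] at hab; omega)
      refine hS.cotransition_of_anti hi hanti fun b hb hdef => ?_
      have hlt : i < b := by rw [Fin.lt_def]; omega
      obtain ⟨b', hb', hwb⟩ := hi.exists_next hanti
      obtain rfl : b = b' := Fin.ext (by omega)
      have hasc' : w i < w b := by rw [hwb]; exact hi.2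
      have := IH _ (permWeight_mul_swap_lt hlt hasc') hdef rfl
      simpa using this

end Cotransition

section Hitting

variable {n : ℕ}

/-- The number of entries of the permutation matrix of `w` weakly north-west of `(p, q)`. -/
def cornerSet (w : Equiv.Perm (Fin n)) (p q : Fin n) : Finset (Fin n) :=
  Finset.univ.filter (fun a => a ≤ p ∧ w a ≤ q)

lemma mem_cornerSet {w : Equiv.Perm (Fin n)} {p q a : Fin n} :
    a ∈ cornerSet w p q ↔ a ≤ p ∧ w a ≤ q := by simp [cornerSet]

/-- A set of cells running strictly from south-west to north-east. -/
def IsNEChain (A : Finset (Fin n × Fin n)) : Prop :=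
  ∀ x ∈ A, ∀ y ∈ A, x ≠ y → (x.1 < y.1 ∧ y.2 < x.2) ∨ (y.1 < x.1 ∧ x.2 < y.2)

/-- All north-east chains in `F` obey the rank conditions of `w`. -/
def ChainBounded (w : Equiv.Perm (Fin n)) (F : Finset (Fin n × Fin n)) : Prop :=
  ∀ p q : Fin n, ∀ A ⊆ F, IsNEChain A → (∀ x ∈ A, x.1 ≤ p ∧ x.2 ≤ q) →
    A.card ≤ (cornerSet w p q).card

lemma IsNEChain.mono {A B : Finset (Fin n × Fin n)} (hA : IsNEChain A) (h : B ⊆ A) :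
    IsNEChain B := fun x hx y hy => hA x (h hx) y (h hy)

lemma IsNEChain.col_lt {A : Finset (Fin n × Fin n)} (hA : IsNEChain A) {x y : Fin n × Fin n}
    (hx : x ∈ A) (hy : y ∈ A) (h : x.1 < y.1) : y.2 < x.2 := by
  rcases hA x hx y hy (fun e => by rw [e] at h; exact lt_irrefl _ h) with h1 | h1
  · exact h1.2
  · exact absurd h1.1 (not_lt.2 h.le)

lemma IsNEChain.col_le {A : Finset (Fin n × Fin n)} (hA : IsNEChain A) {x y : Fin n × Fin n}
    (hx : x ∈ A) (hy : y ∈ A) (h : x.1 ≤ y.1) : y.2 ≤ x.2 := by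
  by_cases e : x = y
  · rw [e]
  · rcases hA x hx y hy e with h1 | h1
    · exact h1.2.le
    · exact absurd h1.1 (not_lt.2 h)

lemma IsNEChain.union {A B : Finset (Fin n × Fin n)} (hA : IsNEChain A) (hB : IsNEChain B)
    (h : ∀ x ∈ A, ∀ y ∈ B, x.1 < y.1 ∧ y.2 < x.2) :
    IsNEChain (A ∪ B) ∧ (A ∪ B).card = A.card + B.card := by
  constructor
  · intro x hx y hy hxy
    rw [Finset.mem_union] at hx hy
    rcases hx with hx | hx <;> rcases hy with hy | hy
    · exact hA x hx y hy hxy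
    · exact Or.inl (h x hx y hy)
    · exact Or.inr (h y hy x hx)
    · exact hB x hx y hy hxy
  · apply Finset.card_union_of_disjoint
    rw [Finset.disjoint_left]
    intro x hx hx'
    exact lt_irrefl _ (h x hx x hx').1

lemma IsNEChain.uncross {A₁ A₂ : Finset (Fin n × Fin n)} {p p' q q' : Fin n}
    (h₁ : IsNEChain A₁) (h₂ : IsNEChain A₂) (hb₁ : ∀ x ∈ A₁, x.1 ≤ p ∧ x.2 ≤ q)
    (hb₂ : ∀ x ∈ A₂, x.1 ≤ p' ∧ x.2 ≤ q') (hp : p ≤ p') (hq : q' ≤ q) :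
    ∃ B C : Finset (Fin n × Fin n), B ⊆ A₁ ∪ A₂ ∧ C ⊆ A₁ ∪ A₂ ∧ IsNEChain B ∧ IsNEChain C ∧
      (∀ x ∈ B, x.1 ≤ p' ∧ x.2 ≤ q) ∧ (∀ x ∈ C, x.1 ≤ p ∧ x.2 ≤ q') ∧
      A₁.card + A₂.card ≤ B.card + C.card := by
  by_cases hhit : ∃ d ∈ A₂, ∃ c ∈ A₁, c.1 ≤ d.1 ∧ c.2 ≤ d.2
  · obtain ⟨d, hd, hdmin⟩ := Finset.exists_min_image
      (A₂.filter (fun d => ∃ c ∈ A₁, c.1 ≤ d.1 ∧ c.2 ≤ d.2)) (fun d => d.1)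
      (by obtain ⟨d, hd, h⟩ := hhit; exact ⟨d, Finset.mem_filter.2 ⟨hd, h⟩⟩)
    rw [Finset.mem_filter] at hd
    obtain ⟨hd, hdc⟩ := hd
    obtain ⟨c, hc, hcmin⟩ := Finset.exists_min_image
      (A₁.filter (fun c => c.1 ≤ d.1 ∧ c.2 ≤ d.2)) (fun c => c.1)
      (by obtain ⟨c, hc, h⟩ := hdc; exact ⟨c, Finset.mem_filter.2 ⟨hc, h⟩⟩)
    rw [Finset.mem_filter] at hc
    obtain ⟨hc, hcd⟩ := hc
    have hBu := IsNEChain.union (h₁.mono (Finset.filter_subset (fun x => x.1 < c.1) A₁))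
      (h₂.mono (Finset.filter_subset (fun x => ¬ x.1 < d.1) A₂)) (by
        intro x hx y hy
        rw [Finset.mem_filter, not_lt] at *
        refine ⟨(hx.2.trans_le hcd.1).trans_le hy.2, ?_⟩
        refine (h₂.col_le hd hy.1 hy.2).trans_lt ?_
        by_contra hlt
        have := hcmin x (Finset.mem_filter.2 ⟨hx.1, (hx.2.trans_le hcd.1).le, not_lt.1 hlt⟩)
        exact absurd hx.2 (not_lt.2 this))
    have hCu := IsNEChain.union (h₂.mono (Finset.filter_subset (fun x => x.1 < d.1) A₂))
      (h₁.mono (Finset.filter_subset (fun x => ¬ x.1 < c.1) A₁)) (by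
        intro y hy x hx
        rw [Finset.mem_filter, not_lt] at *
        have hy2 : d.2 < y.2 := h₂.col_lt hy.1 hd hy.2
        refine ⟨lt_of_lt_of_le ?_ hx.2,
          (h₁.col_le hc hx.1 hx.2).trans_lt (hcd.2.trans_lt hy2)⟩
        by_contra hlt
        have := hdmin y (Finset.mem_filter.2 ⟨hy.1, c, hc, not_lt.1 hlt, hcd.2.trans hy2.le⟩)
        exact absurd hy.2 (not_lt.2 this))
    refine ⟨_, _, ?_, ?_, hBu.1, hCu.1, ?_, ?_, ?_⟩
    · exact Finset.union_subset_union (Finset.filter_subset _ _) (Finset.filter_subset _ _)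
    · rw [Finset.union_comm]
      exact Finset.union_subset_union (Finset.filter_subset _ _) (Finset.filter_subset _ _)
    · intro x hx
      rw [Finset.mem_union, Finset.mem_filter, Finset.mem_filter] at hx
      rcases hx with hx | hx
      · exact ⟨(hb₁ x hx.1).1.trans hp, (hb₁ x hx.1).2⟩
      · exact ⟨(hb₂ x hx.1).1, (hb₂ x hx.1).2.trans hq⟩
    · intro x hx
      rw [Finset.mem_union, Finset.mem_filter, Finset.mem_filter] at hx
      rcases hx with hx | hx
      · refine ⟨?_, (hb₂ x hx.1).2⟩
        have hy2 : d.2 < x.2 := h₂.col_lt hx.1 hd hx.2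
        by_contra hlt
        have := hdmin x (Finset.mem_filter.2 ⟨hx.1, c, hc, (hb₁ c hc).1.trans (not_le.1 hlt).le,
          hcd.2.trans hy2.le⟩)
        exact absurd hx.2 (not_lt.2 this)
      · exact ⟨(hb₁ x hx.1).1, (h₁.col_le hc hx.1 (not_lt.1 hx.2)).trans
          (hcd.2.trans (hb₂ d hd).2)⟩
    · rw [hBu.2, hCu.2]
      have e1 := Finset.card_filter_add_card_filter_not (s := A₁) (fun x => x.1 < c.1)
      have e2 := Finset.card_filter_add_card_filter_not (s := A₂) (fun x => x.1 < d.1)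
      omega
  · rcases A₁.eq_empty_or_nonempty with rfl | hne
    · exact ⟨A₂, ∅, by simp, by simp, h₂, fun x hx => by simp at hx,
        fun x hx => ⟨(hb₂ x hx).1, (hb₂ x hx).2.trans hq⟩, by simp, by simp⟩
    obtain ⟨c, hc, hcmax⟩ := Finset.exists_max_image A₁ (fun c => c.1) hne
    push Not at hhit
    have hBu := IsNEChain.union h₁
      (h₂.mono (Finset.filter_subset (fun x => ¬ x.1 ≤ c.1) A₂)) (by
        intro x hx y hy
        rw [Finset.mem_filter, not_le] at *
        exact ⟨(hcmax x hx).trans_lt hy.2,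
          (hhit y hy.1 c hc hy.2.le).trans_le (h₁.col_le hx hc (hcmax x hx))⟩)
    refine ⟨_, A₂.filter (fun x => x.1 ≤ c.1), ?_, ?_, hBu.1,
      h₂.mono (Finset.filter_subset _ _), ?_, ?_, ?_⟩
    · exact Finset.union_subset_union subset_rfl (Finset.filter_subset _ _)
    · exact (Finset.filter_subset _ _).trans Finset.subset_union_right
    · intro x hx
      rw [Finset.mem_union, Finset.mem_filter] at hx
      rcases hx with hx | hx
      · exact ⟨(hb₁ x hx).1.trans hp, (hb₁ x hx).2⟩
      · exact ⟨(hb₂ x hx.1).1, (hb₂ x hx.1).2.trans hq⟩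
    · intro x hx
      rw [Finset.mem_filter] at hx
      exact ⟨hx.2.trans (hb₁ c hc).1, (hb₂ x hx.1).2⟩
    · rw [hBu.2]
      have e2 := Finset.card_filter_add_card_filter_not (s := A₂) (fun x => x.1 ≤ c.1)
      omega

lemma card_cornerSet_le_swap_add_one {w : Equiv.Perm (Fin n)} {i l : Fin n}
    (hw : w i < w l) (p q : Fin n) :
    (cornerSet w p q).card ≤ (cornerSet (w * Equiv.swap i l) p q).card + 1 := by
  refine le_trans (Finset.card_le_card (t := insert i (cornerSet (w * Equiv.swap i l) p q)) ?_)
    (Finset.card_insert_le _ _)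
  intro a ha
  rw [Finset.mem_insert, mem_cornerSet, Equiv.Perm.mul_apply]
  rw [mem_cornerSet] at ha
  by_cases h1 : a = i
  · exact Or.inl h1
  right
  by_cases h2 : a = l
  · subst h2
    rw [Equiv.swap_apply_right]
    exact ⟨ha.1, hw.le.trans ha.2⟩
  · rw [Equiv.swap_apply_of_ne_of_ne h1 h2]
    exact ha

lemma card_cornerSet_le_swap {w : Equiv.Perm (Fin n)} {i l : Fin n} (hil : i < l)
    (hw : w i < w l) (p q : Fin n) (h : ¬ (i ≤ p ∧ p < l ∧ w i ≤ q ∧ q < w l)) :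
    (cornerSet w p q).card ≤ (cornerSet (w * Equiv.swap i l) p q).card := by
  by_cases hc : i ≤ p ∧ w i ≤ q ∧ l ≤ p ∧ q < w l
  · obtain ⟨h1, h2, h3, h4⟩ := hc
    have hl : l ∈ cornerSet (w * Equiv.swap i l) p q := by
      rw [mem_cornerSet, Equiv.Perm.mul_apply, Equiv.swap_apply_right]
      exact ⟨h3, h2⟩
    rw [← Finset.card_erase_add_one hl]
    refine le_trans (Finset.card_le_card
      (t := insert i ((cornerSet (w * Equiv.swap i l) p q).erase l)) ?_)
      (Finset.card_insert_le _ _)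
    intro a ha
    rw [Finset.mem_insert, Finset.mem_erase, mem_cornerSet, Equiv.Perm.mul_apply]
    rw [mem_cornerSet] at ha
    by_cases c1 : a = i
    · exact Or.inl c1
    by_cases c2 : a = l
    · subst c2; exact absurd h4 (not_lt.2 ha.2)
    right
    rw [Equiv.swap_apply_of_ne_of_ne c1 c2]
    exact ⟨c2, ha⟩
  · apply Finset.card_le_card
    intro a ha
    rw [mem_cornerSet, Equiv.Perm.mul_apply]
    rw [mem_cornerSet] at ha
    by_cases c1 : a = i
    · subst c1
      rw [Equiv.swap_apply_left]
      refine ⟨ha.1, ?_⟩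
      by_contra hlt
      rw [not_le] at hlt
      rcases lt_or_ge p l with h3 | h3
      · exact h ⟨ha.1, h3, ha.2, hlt⟩
      · exact hc ⟨ha.1, ha.2, h3, hlt⟩
    by_cases c2 : a = l
    · subst c2
      rw [Equiv.swap_apply_right]
      exact ⟨ha.1, hw.le.trans ha.2⟩
    · rw [Equiv.swap_apply_of_ne_of_ne c1 c2]
      exact ha

lemma IsFirstDefect.le_of_apply_le_rev {w : Equiv.Perm (Fin n)} {i a : Fin n}
    (hi : IsFirstDefect w i) (h : w a ≤ Fin.rev i) : i ≤ a := by
  by_contra hc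
  rw [not_le] at hc
  rw [hi.1 a hc, Fin.rev_le_rev] at h
  exact absurd hc (not_lt.2 h)

lemma IsFirstDefect.exists_gt {w : Equiv.Perm (Fin n)} {i q : Fin n}
    (hi : IsFirstDefect w i) (hq : w i < q) (hq' : q ≤ Fin.rev i) : ∃ a, i < a ∧ w a = q := by
  obtain ⟨a, rfl⟩ := w.surjective q
  refine ⟨a, lt_of_le_of_ne (hi.le_of_apply_le_rev hq') ?_, rfl⟩
  rintro rfl
  exact lt_irrefl _ hq

/-- The combinatorial heart: a chain-bounded set stays chain-bounded for some cover. -/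
theorem ChainBounded.exists_cover {w : Equiv.Perm (Fin n)} {i : Fin n} (hi : IsFirstDefect w i)
    {F : Finset (Fin n × Fin n)} (hF : ChainBounded w F) :
    ∃ l ∈ coverPositions w i, ChainBounded (w * Equiv.swap i l) (F.erase (i, w i)) := by
  by_contra! hno
  set F' := F.erase (i, w i) with hF'
  have hFF : F' ⊆ F := Finset.erase_subset _ _
  let Crit : Fin n → Fin n → Prop := fun p q => i ≤ p ∧ w i ≤ q ∧ ∃ A ⊆ F', IsNEChain A ∧
    (∀ x ∈ A, x.1 ≤ p ∧ x.2 ≤ q) ∧ (cornerSet w p q).card ≤ A.card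
  have hcrit : ∀ l ∈ coverPositions w i, ∃ p q, Crit p q ∧ p < l ∧ q < w l := by
    intro l hl
    have := hno l hl
    rw [mem_coverPositions] at hl
    unfold ChainBounded at this
    push Not at this
    obtain ⟨p, q, A, hA, hch, hbox, hcard⟩ := this
    have h1 := hF p q A (hA.trans hFF) hch hbox
    have h2 : i ≤ p ∧ p < l ∧ w i ≤ q ∧ q < w l := by
      by_contra h
      have := card_cornerSet_le_swap hl.1 hl.2.1 p q h
      omega
    have h3 := card_cornerSet_le_swap_add_one hl.2.1 p q
    exact ⟨p, q, ⟨h2.1, h2.2.2.1, A, hA, hch, hbox, by omega⟩, h2.2.1, h2.2.2.2⟩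
  obtain ⟨k, hk, hwk⟩ := hi.exists_gt hi.2 le_rfl
  obtain ⟨l₁, hl₁, hmin₁⟩ := (Finset.univ.filter (fun a => i < a ∧ w i < w a)).exists_min_image
    id ⟨k, by simp only [Finset.mem_filter, Finset.mem_univ, true_and]; exact ⟨hk, hwk ▸ hi.2⟩⟩
  simp only [Finset.mem_filter, Finset.mem_univ, true_and, id] at hl₁ hmin₁
  have hl₁c : l₁ ∈ coverPositions w i := by
    rw [mem_coverPositions]
    exact ⟨hl₁.1, hl₁.2, fun a h1 h2 h3 => absurd h2 (not_lt.2 (hmin₁ a ⟨h1, h3.1⟩))⟩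
  classical
  obtain ⟨q, hq, hqmin⟩ := (Finset.univ.filter (fun q => ∃ p, Crit p q ∧ p < l₁)).exists_min_image
    id (by
      obtain ⟨p, q, h1, h2, -⟩ := hcrit l₁ hl₁c
      exact ⟨q, by simp only [Finset.mem_filter, Finset.mem_univ, true_and]; exact ⟨p, h1, h2⟩⟩)
  simp only [Finset.mem_filter, Finset.mem_univ, true_and, id] at hq hqmin
  obtain ⟨p, ⟨hip, hjq, A, hA, hch, hbox, hcard⟩, hpl⟩ := hq
  rcases hjq.eq_or_lt with heq | hlt
  · have himg : A.image Prod.fst ⊆ (cornerSet w p q).erase i := by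
      intro a ha
      rw [Finset.mem_image] at ha
      obtain ⟨x, hx, rfl⟩ := ha
      obtain ⟨hx1, hx2⟩ := hbox x hx
      have hone := hF x.1 x.2 {x} (by simpa using hFF (hA hx)) (by
        intro y hy z hz hyz
        rw [Finset.mem_singleton] at hy hz
        exact absurd (hy.trans hz.symm) hyz) (by simp)
      rw [Finset.card_singleton, Nat.succ_le_iff, Finset.card_pos] at hone
      obtain ⟨a, ha⟩ := hone
      rw [mem_cornerSet] at ha
      have hwa : w a ≤ w i := (ha.2.trans hx2).trans heq.ge
      have hia : i ≤ a := hi.le_of_apply_le_rev (hwa.trans hi.2.le)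
      have hix : i ≠ x.1 := by
        intro e
        have : a = i := le_antisymm (e ▸ ha.1) hia
        subst this
        have hxa : x = (a, w a) := Prod.ext e.symm (le_antisymm (heq ▸ hx2) ha.2)
        have hm := hA hx
        rw [hF', hxa] at hm
        exact Finset.notMem_erase _ _ hm
      have hlt : i < x.1 := lt_of_le_of_ne (hia.trans ha.1) hix
      rw [Finset.mem_erase, mem_cornerSet]
      refine ⟨hix.symm, hx1, ?_⟩
      rw [← heq]
      by_contra hc
      exact absurd (hx1.trans_lt hpl) (not_lt.2 (hmin₁ _ ⟨hlt, not_le.1 hc⟩))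
    have hinj : (A.image Prod.fst).card = A.card := by
      apply Finset.card_image_of_injOn
      intro x hx y hy hxy
      by_contra hne
      rcases hch x hx y hy hne with h | h
      · exact h.1.ne hxy
      · exact h.1.ne' hxy
    have h1 := Finset.card_le_card himg
    rw [hinj] at h1
    have h2 := Finset.card_erase_lt_of_mem (show i ∈ cornerSet w p q from
      mem_cornerSet.2 ⟨hip, heq.le⟩)
    omega
  · have hsucc : ∃ a, i < a ∧ w i < w a ∧ w a ≤ q := by
      have hj1 : (w i : ℕ) + 1 < n := by have := q.2; rw [Fin.lt_def] at hlt; omega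
      obtain ⟨a, ha, hwa⟩ := hi.exists_gt (q := ⟨w i + 1, hj1⟩) (by simp [Fin.lt_def]) (by
        have := hi.2
        rw [Fin.lt_def] at this
        rw [Fin.le_def]; simp only; omega)
      refine ⟨a, ha, ?_, ?_⟩ <;> rw [hwa]
      · simp [Fin.lt_def]
      · rw [Fin.lt_def] at hlt; rw [Fin.le_def]; simp only; omega
    obtain ⟨l₂, hl₂, hmin₂⟩ :=
      (Finset.univ.filter (fun a => i < a ∧ w i < w a ∧ w a ≤ q)).exists_min_image
      id (by
        obtain ⟨a, ha⟩ := hsucc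
        exact ⟨a, by simpa using ha⟩)
    simp only [Finset.mem_filter, Finset.mem_univ, true_and, id] at hl₂ hmin₂
    have hl₂c : l₂ ∈ coverPositions w i := by
      rw [mem_coverPositions]
      exact ⟨hl₂.1, hl₂.2.1, fun a h1 h2 h3 =>
        absurd h2 (not_lt.2 (hmin₂ a ⟨h1, h3.1, h3.2.le.trans hl₂.2.2⟩))⟩
    obtain ⟨p', q', hc', hp', hq'⟩ := hcrit l₂ hl₂c
    have hqq : q' < q := hq'.trans_le hl₂.2.2
    have hpp : p < p' := by
      by_contra hc
      exact absurd hqq (not_lt.2 (hqmin q' ⟨p', hc', (not_lt.1 hc).trans_lt hpl⟩))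
    obtain ⟨hip', hjq', A', hA', hch', hbox', hcard'⟩ := hc'
    obtain ⟨B, C, hB, hC, hBc, hCc, hBb, hCb, hBC⟩ := hch.uncross hch' hbox hbox' hpp.le hqq.le
    have hu : cornerSet w p q ∪ cornerSet w p' q' = cornerSet w p' q := by
      ext a
      rw [Finset.mem_union, mem_cornerSet, mem_cornerSet, mem_cornerSet]
      constructor
      · rintro (h | h)
        · exact ⟨h.1.trans hpp.le, h.2⟩
        · exact ⟨h.1, h.2.trans hqq.le⟩
      · rintro ⟨h1, h2⟩
        by_contra hc
        rw [not_or, not_and_or, not_and_or] at hc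
        have h3 := not_le.1 (hc.1.resolve_right (fun h => h h2))
        have h4 := not_le.1 (hc.2.resolve_left (fun h => h h1))
        exact absurd (h1.trans_lt hp') (not_lt.2 (hmin₂ a ⟨hip.trans_lt h3, hjq'.trans_lt h4, h2⟩))
    have hin : cornerSet w p q ∩ cornerSet w p' q' = cornerSet w p q' := by
      ext a
      rw [Finset.mem_inter, mem_cornerSet, mem_cornerSet, mem_cornerSet]
      constructor
      · rintro ⟨h1, h2⟩
        exact ⟨h1.1, h2.2⟩
      · rintro ⟨h1, h2⟩
        exact ⟨⟨h1, h2.trans hqq.le⟩, h1.trans hpp.le, h2⟩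
    have hcu := Finset.card_union_add_card_inter (cornerSet w p q) (cornerSet w p' q')
    rw [hu, hin] at hcu
    have hAA : A ∪ A' ⊆ F' := Finset.union_subset hA hA'
    have hBF := hF p' q B ((hB.trans hAA).trans hFF) hBc hBb
    exact absurd hqq (not_lt.2 (hqmin q' ⟨p, ⟨hip, hjq', C, hC.trans hAA, hCc, hCb, by omega⟩,
      hpl⟩))

end Hitting

section Degeneration

/-- A family that degenerates to one with a vanishing member is independent as soon as the
other members of the degenerate family are. -/
lemma algebraicIndependent_of_degeneration {k R ι : Type*} [Field k] [CommRing R] [IsDomain R]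
    [Algebra k R] {a b : ι → R} {e₀ : ι} (hab : ∀ f : MvPolynomial ι k, aeval a f = 0 → aeval b f = 0)
    (hb₀ : b e₀ = 0) (ha₀ : a e₀ ≠ 0)
    (hb : AlgebraicIndependent k (fun e : {e // e ≠ e₀} => b e)) : AlgebraicIndependent k a := by
  classical
  rw [algebraicIndependent_iff]
  intro f
  induction hd : f.totalDegree using Nat.strong_induction_on generalizing f with
  | _ d IH =>
    intro hf
    by_contra hf0
    let κ : MvPolynomial ι k →ₐ[k] MvPolynomial {e // e ≠ e₀} k :=
      aeval (fun e => if h : e ≠ e₀ then X ⟨e, h⟩ else 0)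
    have hκ : (aeval (fun e : {e // e ≠ e₀} => b e)).comp κ = aeval (R := k) b := by
      apply MvPolynomial.algHom_ext
      intro e
      by_cases h : e = e₀
      · simp [κ, h, hb₀]
      · simp [κ, h]
    have hκf : κ f = 0 := by
      apply (algebraicIndependent_iff.1 hb)
      rw [← AlgHom.comp_apply, hκ]
      exact hab f hf
    let I : Ideal (MvPolynomial ι k) := Ideal.span {X e₀}
    have hρ : (Ideal.Quotient.mkₐ k I).comp ((rename Subtype.val).comp κ) =
        Ideal.Quotient.mkₐ k I := by
      apply MvPolynomial.algHom_ext
      intro e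
      by_cases h : e = e₀
      · subst h
        simp only [AlgHom.comp_apply, κ, aeval_X, ne_eq, not_true_eq_false, dite_false, map_zero]
        symm
        exact Ideal.Quotient.eq_zero_iff_mem.2 (Ideal.mem_span_singleton_self _)
      · simp [κ, h]
    have hfI : f ∈ I := by
      rw [← Ideal.Quotient.eq_zero_iff_mem]
      have := DFunLike.congr_fun hρ f
      simp only [AlgHom.comp_apply, hκf, map_zero] at this
      exact this.symm
    obtain ⟨g, hg⟩ := Ideal.mem_span_singleton.1 hfI
    have hg0 : g ≠ 0 := by rintro rfl; exact hf0 (by rw [hg, mul_zero])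
    have hdeg : f.totalDegree = 1 + g.totalDegree := by
      rw [hg, totalDegree_mul_of_isDomain (X_ne_zero e₀) hg0, totalDegree_X]
    refine hg0 (IH g.totalDegree (by omega) g rfl ?_)
    rw [hg, map_mul, aeval_X] at hf
    exact (mul_eq_zero.1 hf).resolve_left ha₀

variable {n : ℕ}

/-- The index type of the entries of a lower and an upper triangular matrix. -/
abbrev TriVar (n : ℕ) : Type := (Fin n × Fin n) ⊕ (Fin n × Fin n)

/-- The entries of the generic element of `B₋ w B₊`. -/
noncomputable def cellEntry (w : Equiv.Perm (Fin n)) (e : Fin n × Fin n) :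
    MvPolynomial (TriVar n) ℚ :=
  ∑ a ∈ cornerSet w e.1 e.2, X (Sum.inl (e.1, a)) * X (Sum.inr (w a, e.2))

lemma aeval_cellEntry {K : Type*} [CommRing K] [Algebra ℚ K] (L U : Fin n → Fin n → K)
    (hL : ∀ x a, x < a → L x a = 0) (hU : ∀ c y, y < c → U c y = 0) (w : Equiv.Perm (Fin n))
    (e : Fin n × Fin n) :
    aeval (Sum.elim (fun p => L p.1 p.2) (fun p => U p.1 p.2)) (cellEntry w e) =
      ∑ a, L e.1 a * U (w a) e.2 := by
  rw [cellEntry, map_sum]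
  simp only [map_mul, aeval_X, Sum.elim_inl, Sum.elim_inr]
  apply Finset.sum_subset (Finset.subset_univ _)
  intro a _ ha
  rw [mem_cornerSet, not_and_or, not_le, not_le] at ha
  rcases ha with h | h
  · rw [hL _ _ h, zero_mul]
  · rw [hU _ _ h, mul_zero]

lemma aeval_eq_zero_of_cellEntry {K : Type*} [CommRing K] [Algebra ℚ K] {L U : Fin n → Fin n → K}
    (hL : ∀ x a, x < a → L x a = 0) (hU : ∀ c y, y < c → U c y = 0) {w : Equiv.Perm (Fin n)}
    {f : MvPolynomial (Fin n × Fin n) ℚ} (hf : aeval (cellEntry w) f = 0) :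
    aeval (fun e : Fin n × Fin n => ∑ a, L e.1 a * U (w a) e.2) f = 0 := by
  have := congrArg (aeval (R := ℚ) (Sum.elim (fun p : Fin n × Fin n => L p.1 p.2)
    (fun p => U p.1 p.2))) hf
  rw [map_zero, ← AlgHom.comp_apply, comp_aeval] at this
  simpa only [aeval_cellEntry L U hL hU] using this

lemma cellEntry_eq_sum (w : Equiv.Perm (Fin n)) (e : Fin n × Fin n) :
    cellEntry w e = ∑ a, (if a ≤ e.1 then X (Sum.inl (e.1, a)) else 0) *
      (if w a ≤ e.2 then X (Sum.inr (w a, e.2)) else 0) := by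
  have := aeval_cellEntry (K := MvPolynomial (TriVar n) ℚ)
    (fun x a => if a ≤ x then X (Sum.inl (x, a)) else 0)
    (fun c y => if c ≤ y then X (Sum.inr (c, y)) else 0)
    (fun x a h => if_neg (not_le.2 h)) (fun c y h => if_neg (not_le.2 h)) w e
  rw [← this, cellEntry, map_sum]
  refine Finset.sum_congr rfl fun a ha => ?_
  rw [mem_cornerSet] at ha
  simp [ha.1, ha.2]

lemma cellEntry_ne_zero {w : Equiv.Perm (Fin n)} {e : Fin n × Fin n}
    (h : (cornerSet w e.1 e.2).Nonempty) : cellEntry w e ≠ 0 := by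
  intro h0
  have := congrArg (eval (fun _ => (1 : ℚ))) h0
  simp only [cellEntry, map_sum, map_mul, eval_X, mul_one, map_zero, Finset.sum_const,
    nsmul_eq_mul, Nat.cast_eq_zero, Finset.card_eq_zero] at this
  exact h.ne_empty this

lemma cellEntry_eq_zero {w : Equiv.Perm (Fin n)} {e : Fin n × Fin n}
    (h : cornerSet w e.1 e.2 = ∅) : cellEntry w e = 0 := by
  rw [cellEntry, h, Finset.sum_empty]

/-- The relations between the entries for `w` hold for the permutations above it. -/
lemma aeval_cellEntry_mul_swap {w : Equiv.Perm (Fin n)} {i l : Fin n} (hil : i < l)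
    (hw : w i < w l) {f : MvPolynomial (Fin n × Fin n) ℚ} (hf : aeval (cellEntry w) f = 0) :
    aeval (cellEntry (w * Equiv.swap i l)) f = 0 := by
  let R := MvPolynomial (TriVar n) ℚ
  let K := FractionRing (Polynomial R)
  let ι : Polynomial R →ₐ[ℚ] K := IsScalarTower.toAlgHom ℚ (Polynomial R) K
  have hι : Function.Injective ι := IsFractionRing.injective (Polynomial R) K
  let ε : K := ι Polynomial.X
  have hε : ε ≠ 0 := by
    intro h
    exact Polynomial.X_ne_zero (hι (h.trans (map_zero ι).symm))
  let L₀ : Fin n → Fin n → R := fun x a => if a ≤ x then X (Sum.inl (x, a)) else 0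
  let U₀ : Fin n → Fin n → R := fun c y => if c ≤ y then X (Sum.inr (c, y)) else 0
  have hL₀ : ∀ x a, x < a → L₀ x a = 0 := fun x a h => if_neg (not_le.2 h)
  have hU₀ : ∀ c y, y < c → U₀ c y = 0 := fun c y h => if_neg (not_le.2 h)
  let L : Fin n → Fin n → K := fun x a => ι (Polynomial.C (L₀ x a))
  let U : Fin n → Fin n → K := fun c y => ι (Polynomial.C (U₀ c y))
  have hLz : ∀ x a, x < a → L x a = 0 := fun x a h => by simp [L, hL₀ x a h]
  have hUz : ∀ c y, y < c → U c y = 0 := fun c y h => by simp [U, hU₀ c y h]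
  let L' : Fin n → Fin n → K := fun x a =>
    if a = i then ε * L x i + L x l else if a = l then -ε⁻¹ * L x l else L x a
  let U' : Fin n → Fin n → K := fun c y =>
    if c = w i then U (w i) y + ε⁻¹ * U (w l) y else U c y
  have hL' : ∀ x a, x < a → L' x a = 0 := by
    intro x a h
    simp only [L']
    split_ifs with h1 h2
    · subst h1; rw [hLz _ _ h, hLz _ _ (h.trans hil)]; ring
    · subst h2; rw [hLz _ _ h]; ring
    · exact hLz _ _ h
  have hU' : ∀ c y, y < c → U' c y = 0 := by
    intro c y h
    simp only [U']
    split_ifs with h1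
    · subst h1; rw [hUz _ _ h, hUz _ _ (h.trans hw)]; ring
    · exact hUz _ _ h
  let N : Fin n × Fin n → Polynomial R := fun e =>
    Polynomial.C (cellEntry (w * Equiv.swap i l) e) +
      Polynomial.X * Polynomial.C (L₀ e.1 i * U₀ (w i) e.2)
  have hN : ∀ e : Fin n × Fin n, ∑ a, L' e.1 a * U' (w a) e.2 = ι (N e) := by
    intro e
    have hl : l ∈ Finset.univ.erase i := by simp [hil.ne']
    have h1 : ∀ F : Fin n → K, ∑ a, F a = F i + (F l + ∑ a ∈ (Finset.univ.erase i).erase l, F a) :=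
      fun F => by rw [Finset.add_sum_erase _ _ hl, Finset.add_sum_erase _ _ (Finset.mem_univ i)]
    have h2 : ι (Polynomial.C (cellEntry (w * Equiv.swap i l) e)) =
        ∑ a, L e.1 a * U (w (Equiv.swap i l a)) e.2 := by
      rw [cellEntry_eq_sum, map_sum, map_sum]
      refine Finset.sum_congr rfl fun a _ => ?_
      rw [map_mul, map_mul]
      rfl
    simp only [N]
    rw [map_add, h2, h1, h1]
    have h3 : ∑ a ∈ (Finset.univ.erase i).erase l, L' e.1 a * U' (w a) e.2 =
        ∑ a ∈ (Finset.univ.erase i).erase l, L e.1 a * U (w (Equiv.swap i l a)) e.2 := by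
      refine Finset.sum_congr rfl fun a ha => ?_
      simp only [Finset.mem_erase, Finset.mem_univ, and_true] at ha
      rw [Equiv.swap_apply_of_ne_of_ne ha.2 ha.1]
      simp only [L', U', if_neg ha.2, if_neg ha.1, if_neg (w.injective.ne ha.2)]
    have h4 : w l ≠ w i := hw.ne'
    rw [h3, map_mul, map_mul, map_mul, Equiv.swap_apply_left, Equiv.swap_apply_right]
    change _ = _ + ε * (L e.1 i * U (w i) e.2)
    simp only [L', U', if_true, if_neg hil.ne', if_neg h4]
    linear_combination (L e.1 i * U (w l) e.2) * mul_inv_cancel₀ hε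
  have h1 := aeval_eq_zero_of_cellEntry hL' hU' hf
  simp only [hN] at h1
  have h2 : aeval N f = 0 := by
    apply hι
    rw [map_zero, ← AlgHom.comp_apply, comp_aeval]
    exact h1
  have h3 := congrArg ((Polynomial.aeval (0 : R)).restrictScalars ℚ) h2
  rw [map_zero, ← AlgHom.comp_apply, comp_aeval] at h3
  convert h3 using 3
  simp [N]

/-- Independence passes down a cover at the first defect. -/
lemma algebraicIndependent_cellEntry_erase {w : Equiv.Perm (Fin n)} {i l : Fin n} (hil : i < l)
    (hw : w i < w l) (hc : cornerSet (w * Equiv.swap i l) i (w i) = ∅)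
    {P : Finset (Fin n × Fin n)}
    (hP : AlgebraicIndependent ℚ (fun e : {e // e ∉ P} => cellEntry (w * Equiv.swap i l) e)) :
    AlgebraicIndependent ℚ (fun e : {e // e ∉ P.erase (i, w i)} => cellEntry w e) := by
  refine algebraicIndependent_of_degeneration
    (b := fun e : {e // e ∉ P.erase (i, w i)} => cellEntry (w * Equiv.swap i l) e)
    (e₀ := ⟨(i, w i), Finset.notMem_erase _ _⟩) ?_ (cellEntry_eq_zero hc) ?_ ?_
  · intro f hf
    have h1 : aeval (cellEntry w) (rename Subtype.val f) = 0 := by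
      rw [aeval_rename]; exact hf
    have h2 := aeval_cellEntry_mul_swap hil hw h1
    rw [aeval_rename] at h2
    exact h2
  · exact cellEntry_ne_zero ⟨i, mem_cornerSet.2 ⟨le_rfl, le_rfl⟩⟩
  · have hmem : ∀ e : {e : {e // e ∉ P.erase (i, w i)} // e ≠ ⟨(i, w i), Finset.notMem_erase _ _⟩},
        e.1.1 ∉ P := by
      intro e h
      have h1 := e.1.2
      rw [Finset.mem_erase, not_and] at h1
      exact h1 (fun h2 => e.2 (Subtype.ext h2)) h
    let g : {e : {e // e ∉ P.erase (i, w i)} // e ≠ ⟨(i, w i), Finset.notMem_erase _ _⟩} →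
      {e // e ∉ P} := fun e => ⟨e.1.1, hmem e⟩
    have hg : Function.Injective g := fun e e' h =>
      Subtype.ext (Subtype.ext (congrArg (fun x : {e // e ∉ P} => x.1) h))
    have h1 := AlgebraicIndependent.comp hP g hg
    exact h1

lemma algebraicIndependent_cellEntry_revPerm :
    AlgebraicIndependent ℚ (fun e : {e : Fin n × Fin n // e ∉ Finset.univ.filter
      (fun q : Fin n × Fin n => (q.1 : ℕ) + (q.2 : ℕ) + 2 ≤ n)} =>
      cellEntry Fin.revPerm e.1) := by
  let R := MvPolynomial (TriVar n) ℚ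
  let L : Fin n → Fin n → R := fun x a => if a = x then 1 else 0
  let U : Fin n → Fin n → R := fun c y => if c ≤ y then X (Sum.inr (c, y)) else 0
  apply AlgebraicIndependent.of_comp (aeval (R := ℚ) (Sum.elim (fun p : Fin n × Fin n => L p.1 p.2)
    (fun p => U p.1 p.2)))
  have hX : AlgebraicIndependent ℚ (X : TriVar n → R) := algebraicIndependent_X _ _
  have hinj : Function.Injective (fun e : {e : Fin n × Fin n // e ∉ Finset.univ.filter
      (fun q : Fin n × Fin n => (q.1 : ℕ) + (q.2 : ℕ) + 2 ≤ n)} =>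
      (Sum.inr (Fin.rev e.1.1, e.1.2) : TriVar n)) := by
    intro e e' h
    simp only [Sum.inr.injEq, Prod.mk.injEq, Fin.rev_inj] at h
    exact Subtype.ext (Prod.ext h.1 h.2)
  convert hX.comp _ hinj using 1
  funext e
  obtain ⟨⟨x, y⟩, he⟩ := e
  simp only [Finset.mem_filter, Finset.mem_univ, true_and] at he
  simp only [Function.comp_apply]
  rw [aeval_cellEntry L U (fun x a h => if_neg h.ne') (fun c y h => if_neg (not_le.2 h)),
    Finset.sum_eq_single x]
  · have : Fin.rev x ≤ y := by rw [Fin.le_def, Fin.val_rev]; omega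
    simp [L, U, this]
  · intro a _ ha
    simp [L, ha]
  · simp

end Degeneration

section Support

variable {n : ℕ}

/-- The exponent obtained from a set of cells `P` by recording the row of the cells in `A` and
the column of the other ones. -/
noncomputable def cellExponent (P A : Finset (Fin n × Fin n)) : (Fin n ⊕ Fin n) →₀ ℕ :=
  ∑ e ∈ A, Finsupp.single (Sum.inl e.1) 1 + ∑ e ∈ P \ A, Finsupp.single (Sum.inr e.2) 1

lemma sum_inr_cellExponent (P A : Finset (Fin n × Fin n)) :
    ∑ j, cellExponent P A (Sum.inr j) = (P \ A).card := by
  simp only [cellExponent, Finsupp.add_apply, Finsupp.finsetSum_apply, Finsupp.single_apply,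
    reduceCtorEq, if_false, Finset.sum_const_zero, zero_add, Sum.inr.injEq, Finset.sum_boole,
    Nat.cast_id]
  exact (Finset.card_eq_sum_card_fiberwise (fun _ _ => Finset.mem_coe.2 (Finset.mem_univ _))).symm

lemma degree_cellExponent {P A : Finset (Fin n × Fin n)} (hA : A ⊆ P) :
    (cellExponent P A).degree = P.card := by
  simp [cellExponent, map_sum, Finsupp.degree_single]
  rw [add_comm, Finset.card_sdiff_add_card_eq_card hA]

/-- The linear factors indexed by a set of cells. -/
noncomputable def cellProd (P : Finset (Fin n × Fin n)) : MvPolynomial (Fin n ⊕ Fin n) ℤ :=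
  ∏ e ∈ P, (X (Sum.inl e.1) - X (Sum.inr e.2))

lemma cellProd_eq (P : Finset (Fin n × Fin n)) :
    cellProd P = ∑ A ∈ P.powerset, monomial (cellExponent P A) ((-1) ^ (P \ A).card) := by
  rw [cellProd]
  simp only [sub_eq_add_neg]
  rw [Finset.prod_add]
  refine Finset.sum_congr rfl fun A _ => ?_
  rw [Finset.prod_neg, cellExponent]
  simp only [X]
  rw [← monomial_sum_one, ← monomial_sum_one, mul_left_comm, monomial_mul, one_mul,
    ← C_1, ← C_neg, ← C_pow, C_mul_monomial, mul_one]

lemma coeff_cellProd (P : Finset (Fin n × Fin n)) (m : (Fin n ⊕ Fin n) →₀ ℕ) :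
    coeff m (cellProd P) = (-1) ^ (∑ j, m (Sum.inr j)) *
      ((P.powerset.filter (fun A => cellExponent P A = m)).card : ℤ) := by
  rw [cellProd_eq, coeff_sum]
  simp only [coeff_monomial]
  rw [← Finset.sum_filter, mul_comm, ← nsmul_eq_mul, ← Finset.sum_const]
  refine Finset.sum_congr rfl fun A hA => ?_
  rw [← sum_inr_cellExponent, (Finset.mem_filter.1 hA).2]

/-- There is no cancellation in a sum of products of linear factors. -/
lemma mem_support_sum_cellProd (Ps : Multiset (Finset (Fin n × Fin n)))
    (m : (Fin n ⊕ Fin n) →₀ ℕ) :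
    m ∈ (Ps.map cellProd).sum.support ↔ ∃ P ∈ Ps, ∃ A ⊆ P, cellExponent P A = m := by
  have h : coeff m (Ps.map cellProd).sum = (-1) ^ (∑ j, m (Sum.inr j)) *
      (((Ps.map (fun P => (P.powerset.filter (fun A => cellExponent P A = m)).card)).sum : ℕ) : ℤ) := by
    have h1 := map_multiset_sum (coeffAddMonoidHom (R := ℤ) m) (Ps.map cellProd)
    rw [Multiset.map_map] at h1
    have h2 : (⇑(coeffAddMonoidHom (R := ℤ) m) ∘ cellProd) = fun P : Finset (Fin n × Fin n) =>
        (-1) ^ (∑ j, m (Sum.inr j)) *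
      ((P.powerset.filter (fun A => cellExponent P A = m)).card : ℤ) :=
      funext fun P => coeff_cellProd P m
    rw [h2, Multiset.sum_map_mul_left] at h1
    refine h1.trans ?_
    rw [← Nat.coe_castAddMonoidHom, map_multiset_sum, Multiset.map_map]
    rfl
  rw [mem_support_iff, h, mul_ne_zero_iff]
  simp only [ne_eq, pow_eq_zero_iff', neg_eq_zero, one_ne_zero, false_and, not_false_eq_true,
    true_and, Nat.cast_eq_zero, Multiset.sum_eq_zero_iff, Multiset.mem_map, forall_exists_index,
    and_imp, forall_apply_eq_imp_iff₂, Finset.card_eq_zero, not_forall, exists_prop]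
  refine exists_congr fun P => and_congr_right fun _ => ?_
  rw [← Finset.not_nonempty_iff_eq_empty, not_not]
  simp only [Finset.Nonempty, Finset.mem_filter, Finset.mem_powerset]

/-- A factor of a homogeneous polynomial by a nonzero homogeneous polynomial is homogeneous. -/
lemma isHomogeneous_of_mul {σ R : Type*} [CommRing R] [IsDomain R] {f g : MvPolynomial σ R}
    {k d : ℕ} (hf : f.IsHomogeneous k) (hf0 : f ≠ 0) (h : (f * g).IsHomogeneous d) :
    ∃ e, g.IsHomogeneous e := by
  refine ⟨d - k, ?_⟩
  intro c hc
  have hw : Finsupp.weight (1 : σ → ℕ) c = c.degree :=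
    (DFunLike.congr_fun Finsupp.degree_eq_weight_one c).symm
  rw [hw]
  by_contra hne
  let _ : GradedAlgebra (homogeneousSubmodule σ R) := gradedAlgebra
  have hdec (p : MvPolynomial σ R) (i : ℕ) :
      (DirectSum.decompose (homogeneousSubmodule σ R) p i : MvPolynomial σ R) =
        homogeneousComponent i p := decomposition.decompose'_apply p i
  have h1 := DirectSum.coe_decompose_mul_add_of_left_mem (homogeneousSubmodule σ R)
    (i := k) (j := c.degree) (a := f) (b := g) hf
  have h2 : f * homogeneousComponent c.degree g = homogeneousComponent (k + c.degree) (f * g) := by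
    rw [← hdec, ← hdec]; exact h1.symm
  rw [homogeneousComponent_of_mem h, if_neg (by omega)] at h2
  have h3 := (mul_eq_zero.1 h2).resolve_left hf0
  have h4 := congrArg (coeff c) h3
  rw [coeff_homogeneousComponent, if_pos rfl, coeff_zero] at h4
  exact hc h4

variable {S : Equiv.Perm (Fin n) → MvPolynomial (Fin n ⊕ Fin n) ℤ}

lemma exists_adjacent_ascent {w : Equiv.Perm (Fin n)} (hw : w ≠ Fin.revPerm) :
    ∃ a b : Fin n, (b : ℕ) = a + 1 ∧ w a < w b := by
  by_contra! hno
  obtain ⟨i, hi⟩ := exists_isFirstDefect hw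
  obtain ⟨k, hk, hwk⟩ := hi.exists_gt hi.2 le_rfl
  have : ∀ m : ℕ, ∀ b : Fin n, (b : ℕ) = i + m → w b ≤ w i := by
    intro m
    induction m with
    | zero => intro b hb; exact le_of_eq (congrArg w (Fin.ext hb))
    | succ m ih =>
      intro b hb
      have hc : (i : ℕ) + m < n := by have := b.2; omega
      exact (hno ⟨i + m, hc⟩ b (by simp; omega)).trans (ih ⟨i + m, hc⟩ rfl)
  have h1 := this (k - i) k (by rw [Fin.lt_def] at hk; omega)
  rw [hwk] at h1
  exact absurd hi.2 (not_lt.2 h1)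

lemma IsSchubertFamily.isHomogeneous (hS : IsSchubertFamily S) (w : Equiv.Perm (Fin n)) :
    ∃ d, (S w).IsHomogeneous d := by
  induction hm : permWeight w using Nat.strong_induction_on generalizing w with
  | _ m IH =>
    subst hm
    have hlin : ∀ x y : Fin n ⊕ Fin n,
        (X x - X y : MvPolynomial (Fin n ⊕ Fin n) ℤ).IsHomogeneous 1 :=
      fun x y => (isHomogeneous_X _ _).sub (isHomogeneous_X _ _)
    by_cases hw : w = Fin.revPerm
    · rw [hw, hS.rev]
      exact ⟨_, IsHomogeneous.prod _ _ (fun _ => 1) fun q _ => hlin _ _⟩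
    · obtain ⟨a, b, hab, h⟩ := exists_adjacent_ascent hw
      have hlt : a < b := by rw [Fin.lt_def]; omega
      obtain ⟨d, hd⟩ := IH _ (permWeight_mul_swap_lt hlt h) _ rfl
      have h1 := hS.desc (w * Equiv.swap a b) a b hab (by simpa using h)
      rw [Equiv.mul_swap_mul_self] at h1
      refine isHomogeneous_of_mul (hlin _ _) (X_inl_sub_X_inl_ne_zero hlt.ne) (d := d) ?_
      rw [h1]
      refine hd.sub ?_
      exact hd.rename_isHomogeneous

/-- The expansion of a double Schubert polynomial obtained by iterating the cotransition formula. -/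
theorem IsSchubertFamily.exists_expansion (hS : IsSchubertFamily S) (w : Equiv.Perm (Fin n)) :
    ∃ Ps : Multiset (Finset (Fin n × Fin n)), S w = (Ps.map cellProd).sum ∧
      (∀ P ∈ Ps, ∀ a b, cornerSet w a b = ∅ → (a, b) ∈ P) ∧
      (∀ P ∈ Ps, AlgebraicIndependent ℚ (fun e : {e // e ∉ P} => cellEntry w e)) ∧
      (∀ F, ChainBounded w F → ∃ P ∈ Ps, Disjoint P F) := by
  induction hm : permWeight w using Nat.strong_induction_on generalizing w with
  | _ m IH =>
    subst hm
    by_cases hw : w = Fin.revPerm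
    · subst hw
      refine ⟨{Finset.univ.filter (fun q : Fin n × Fin n => (q.1 : ℕ) + (q.2 : ℕ) + 2 ≤ n)},
        by simp [hS.rev, cellProd], ?_, ?_, ?_⟩
      · intro P hP a b hab
        rw [Multiset.mem_singleton] at hP
        subst hP
        have : a ∉ cornerSet Fin.revPerm a b := by rw [hab]; simp
        rw [mem_cornerSet, Fin.revPerm_apply, Fin.le_def, Fin.le_def, Fin.val_rev] at this
        simp only [Finset.mem_filter, Finset.mem_univ, true_and]
        omega
      · intro P hP
        rw [Multiset.mem_singleton] at hP
        subst hP
        exact algebraicIndependent_cellEntry_revPerm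
      · intro F hF
        refine ⟨_, Multiset.mem_singleton_self _, ?_⟩
        rw [Finset.disjoint_left]
        intro e he heF
        have h1 := hF e.1 e.2 {e} (by simpa using heF) (by
          intro y hy z hz hyz
          rw [Finset.mem_singleton] at hy hz
          exact absurd (hy.trans hz.symm) hyz) (by simp)
        rw [Finset.card_singleton, Nat.succ_le_iff, Finset.card_pos] at h1
        obtain ⟨a, ha⟩ := h1
        rw [mem_cornerSet, Fin.revPerm_apply, Fin.le_def, Fin.le_def, Fin.val_rev] at ha
        simp only [Finset.mem_filter, Finset.mem_univ, true_and] at he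
        omega
    · obtain ⟨i, hi⟩ := exists_isFirstDefect hw
      have hcov : ∀ l ∈ coverPositions w i, i < l ∧ w i < w l := fun l hl =>
        ⟨(mem_coverPositions.1 hl).1, (mem_coverPositions.1 hl).2.1⟩
      have IH' : ∀ l : Fin n, ∃ Ps : Multiset (Finset (Fin n × Fin n)), l ∈ coverPositions w i →
          S (w * Equiv.swap i l) = (Ps.map cellProd).sum ∧
          (∀ P ∈ Ps, ∀ a b, cornerSet (w * Equiv.swap i l) a b = ∅ → (a, b) ∈ P) ∧
          (∀ P ∈ Ps, AlgebraicIndependent ℚ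
            (fun e : {e // e ∉ P} => cellEntry (w * Equiv.swap i l) e)) ∧
          (∀ F, ChainBounded (w * Equiv.swap i l) F → ∃ P ∈ Ps, Disjoint P F) := by
        intro l
        by_cases hl : l ∈ coverPositions w i
        · obtain ⟨Ps, h⟩ := IH _ (permWeight_mul_swap_lt (hcov l hl).1 (hcov l hl).2) _ rfl
          exact ⟨Ps, fun _ => h⟩
        · exact ⟨0, fun h => absurd h hl⟩
      choose Qs hQs using IH'
      have hcorner : ∀ l ∈ coverPositions w i, cornerSet (w * Equiv.swap i l) i (w i) = ∅ := by
        intro l hl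
        rw [Finset.eq_empty_iff_forall_notMem]
        intro a ha
        rw [mem_cornerSet, Equiv.Perm.mul_apply] at ha
        by_cases hai : a = i
        · rw [hai, Equiv.swap_apply_left] at ha
          exact absurd (hcov l hl).2 (not_lt.2 ha.2)
        · rw [Equiv.swap_apply_of_ne_of_ne hai (ha.1.trans_lt (hcov l hl).1).ne] at ha
          exact hai (le_antisymm ha.1 (hi.le_of_apply_le_rev (ha.2.trans hi.2.le)))
      have hmemP : ∀ l ∈ coverPositions w i, ∀ P ∈ Qs l, (i, w i) ∈ P := fun l hl P hP =>
        (hQs l hl).2.1 P hP _ _ (hcorner l hl)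
      have hmem : ∀ P, P ∈ (coverPositions w i).val.bind
          (fun l => (Qs l).map (fun P => P.erase (i, w i))) ↔
          ∃ l ∈ coverPositions w i, ∃ P' ∈ Qs l, P'.erase (i, w i) = P := by
        intro P
        simp [Multiset.mem_bind]
      refine ⟨(coverPositions w i).val.bind (fun l => (Qs l).map (fun P => P.erase (i, w i))),
        ?_, ?_, ?_, ?_⟩
      · apply mul_left_cancel₀ (X_inl_sub_X_inr_ne_zero i (w i))
        rw [hS.cotransition hi, Multiset.map_bind, Multiset.sum_bind,
          ← Multiset.sum_map_mul_left]
        refine congrArg Multiset.sum (Multiset.map_congr rfl fun l hl => ?_)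
        rw [(hQs l hl).1, Multiset.map_map, ← Multiset.sum_map_mul_left]
        refine congrArg Multiset.sum (Multiset.map_congr rfl fun P hP => ?_)
        exact (Finset.mul_prod_erase P (fun e => (X (Sum.inl e.1) - X (Sum.inr e.2) :
          MvPolynomial (Fin n ⊕ Fin n) ℤ)) (hmemP l hl P hP)).symm
      · intro P hP a b hab
        obtain ⟨l, hl, P', hP', rfl⟩ := (hmem P).1 hP
        rw [Finset.mem_erase]
        constructor
        · intro e
          rw [Prod.mk.injEq] at e
          have : i ∈ cornerSet w a b := by rw [mem_cornerSet, e.1, e.2]; exact ⟨le_rfl, le_rfl⟩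
          rw [hab] at this
          simp at this
        · refine (hQs l hl).2.1 P' hP' a b ?_
          rw [Finset.eq_empty_iff_forall_notMem] at hab ⊢
          intro x hx
          rw [mem_cornerSet, Equiv.Perm.mul_apply] at hx
          by_cases h1 : x = i
          · subst h1
            rw [Equiv.swap_apply_left] at hx
            exact hab x (mem_cornerSet.2 ⟨hx.1, (hcov l hl).2.le.trans hx.2⟩)
          by_cases h2 : x = l
          · subst h2
            rw [Equiv.swap_apply_right] at hx
            exact hab i (mem_cornerSet.2 ⟨(hcov x hl).1.le.trans hx.1, hx.2⟩)
          · rw [Equiv.swap_apply_of_ne_of_ne h1 h2] at hx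
            exact hab x (mem_cornerSet.2 hx)
      · intro P hP
        obtain ⟨l, hl, P', hP', rfl⟩ := (hmem P).1 hP
        exact algebraicIndependent_cellEntry_erase (hcov l hl).1 (hcov l hl).2 (hcorner l hl)
          ((hQs l hl).2.2.1 P' hP')
      · intro F hF
        obtain ⟨l, hl, hF'⟩ := hF.exists_cover hi
        obtain ⟨P', hP', hdis⟩ := (hQs l hl).2.2.2 _ hF'
        refine ⟨_, (hmem _).2 ⟨l, hl, P', hP', rfl⟩, ?_⟩
        rw [Finset.disjoint_left] at hdis ⊢
        intro e he heF
        rw [Finset.mem_erase] at he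
        exact hdis he.2 (Finset.mem_erase.2 ⟨he.1, heF⟩)

end Support

section Polymatroid

/-- The lattice points of the base polytope of a supermodular function form a discrete
polymatroid. -/
lemma isDiscretePolymatroid_of_supermodular {σ : Type*} [Fintype σ] [DecidableEq σ]
    {c : Finset σ → ℕ} (h0 : c ∅ = 0) (hmono : Monotone c)
    (hsup : ∀ I J, c I + c J ≤ c (I ∩ J) + c (I ∪ J)) {P : Set (σ → ℕ)}
    (hP : ∀ x, x ∈ P ↔ (∀ J, c J ≤ ∑ j ∈ J, x j) ∧ ∑ j, x j = c Finset.univ) :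
    IsDiscretePolymatroid P := by
  have hle : ∀ J, c J ≤ c Finset.univ := fun J => hmono (Finset.subset_univ J)
  refine ⟨fun J => c Finset.univ - c Jᶜ, by simp, ?_, ?_, ?_⟩
  · intro I J hIJ
    exact Nat.sub_le_sub_left (hmono (Finset.compl_subset_compl.2 hIJ)) _
  · intro I J
    have h1 := hsup Iᶜ Jᶜ
    rw [← Finset.compl_union, ← Finset.compl_inter] at h1
    have := hle (I ∩ J)ᶜ
    have := hle (I ∪ J)ᶜ
    have := hle Iᶜ
    have := hle Jᶜ
    simp only
    omega
  · ext x
    simp only [hP, Set.mem_ofPred_eq, Finset.compl_univ, h0, Nat.sub_zero]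
    refine and_congr_left fun htot => ?_
    constructor
    · intro h J _
      have h1 := h Jᶜ
      have h2 := Finset.sum_add_sum_compl J x
      omega
    · intro h J
      rcases eq_or_ne J ∅ with rfl | hJ
      · simp [h0]
      have h1 := h Jᶜ (Finset.ssubset_univ_iff.2 (by rwa [Ne, Finset.compl_eq_univ_iff]))
      have h2 := Finset.sum_add_sum_compl J x
      have := hle J
      rw [compl_compl] at h1
      omega

variable {α β : Type*} [Fintype α] [Fintype β] [DecidableEq α] [DecidableEq β]

/-- The cells whose row and column both belong to `J`. -/
def cellsWithin (J : Finset (α ⊕ β)) : Finset (α × β) :=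
  Finset.univ.filter (fun e => Sum.inl e.1 ∈ J ∧ Sum.inr e.2 ∈ J)

@[simp] lemma mem_cellsWithin {J : Finset (α ⊕ β)} {e : α × β} :
    e ∈ cellsWithin J ↔ Sum.inl e.1 ∈ J ∧ Sum.inr e.2 ∈ J := by
  simp [cellsWithin]

lemma cellsWithin_mono {I J : Finset (α ⊕ β)} (h : I ⊆ J) : cellsWithin I ⊆ cellsWithin J :=
  fun _ he => mem_cellsWithin.2 ⟨h (mem_cellsWithin.1 he).1, h (mem_cellsWithin.1 he).2⟩

lemma cellsWithin_inter (I J : Finset (α ⊕ β)) :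
    cellsWithin (I ∩ J) = cellsWithin I ∩ cellsWithin J := by
  ext e
  simp only [mem_cellsWithin, Finset.mem_inter]
  tauto

lemma cellsWithin_univ : cellsWithin (Finset.univ : Finset (α ⊕ β)) = Finset.univ := by
  ext e; simp

/-- A Rado-type theorem: if `ν` is monotone and supermodular, and `x` dominates `ν` on all
rectangles, then some cells can be removed, each charged to its row or to its column according
to `x`, so that `ν` vanishes on the remaining ones. -/
lemma exists_charging {ν : Finset (α × β) → ℕ} (hmono : Monotone ν)
    (hsup : ∀ X Y, ν X + ν Y ≤ ν (X ∩ Y) + ν (X ∪ Y)) (E B : Finset (α × β)) (hEB : Disjoint E B)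
    (x : α ⊕ β → ℕ) (hx : ∀ J, ν (cellsWithin J ∩ E ∪ B) ≤ ∑ j ∈ J, x j) :
    ∃ D₁ D₂ : Finset (α × β), Disjoint D₁ D₂ ∧ D₁ ⊆ E ∧ D₂ ⊆ E ∧ ν (E \ (D₁ ∪ D₂) ∪ B) = 0 ∧
      (∀ i, (D₁.filter (fun e => e.1 = i)).card ≤ x (Sum.inl i)) ∧
      (∀ j, (D₂.filter (fun e => e.2 = j)).card ≤ x (Sum.inr j)) := by
  induction E using Finset.induction_on generalizing B x with
  | empty => exact ⟨∅, ∅, by simp, by simp, by simp, by simpa using hx ∅, by simp, by simp⟩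
  | insert e E he IH =>
    rw [Finset.disjoint_insert_left] at hEB
    have hins : ∀ J, e ∉ cellsWithin J → cellsWithin J ∩ insert e E = cellsWithin J ∩ E :=
      fun J h => Finset.inter_insert_of_notMem h
    have hins' : ∀ J, e ∈ cellsWithin J →
        cellsWithin J ∩ insert e E = insert e (cellsWithin J ∩ E) :=
      fun J h => Finset.inter_insert_of_mem h
    have hsub : ∀ J, ν (cellsWithin J ∩ E ∪ B) ≤ ν (cellsWithin J ∩ insert e E ∪ B) := fun J =>
      hmono (Finset.union_subset_union_left
        (Finset.inter_subset_inter_left (Finset.subset_insert _ _)))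
    have hsum : ∀ I J, ∑ j ∈ I ∩ J, x j + ∑ j ∈ I ∪ J, x j = ∑ j ∈ I, x j + ∑ j ∈ J, x j :=
      fun I J => by rw [add_comm, Finset.sum_union_inter]
    have hdec : ∀ g, (∀ J, g ∈ J → ν (cellsWithin J ∩ E ∪ B) < ∑ j ∈ J, x j) →
        0 < x g ∧ ∀ J, ν (cellsWithin J ∩ E ∪ B) ≤ ∑ j ∈ J, Function.update x g (x g - 1) j := by
      intro g hg
      have hpos : 0 < x g := by
        have := hg {g} (Finset.mem_singleton_self g)
        rw [Finset.sum_singleton] at this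
        omega
      refine ⟨hpos, fun J => ?_⟩
      by_cases hgJ : g ∈ J
      · have h1 := hg J hgJ
        rw [Finset.sum_update_of_mem hgJ]
        rw [← Finset.add_sum_erase J x hgJ, Finset.erase_eq] at h1
        omega
      · rw [Finset.sum_update_of_notMem hgJ]
        exact (hsub J).trans (hx J)
    by_cases hrow : ∀ J, Sum.inl e.1 ∈ J → ν (cellsWithin J ∩ E ∪ B) < ∑ j ∈ J, x j
    · obtain ⟨hpos, h1⟩ := hdec _ hrow
      obtain ⟨D₁, D₂, hD, h₁, h₂, hν, hr, hc⟩ := IH B hEB.2 _ h1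
      have he₁ : e ∉ D₁ := fun h => he (h₁ h)
      have he₂ : e ∉ D₂ := fun h => he (h₂ h)
      refine ⟨insert e D₁, D₂, Finset.disjoint_insert_left.2 ⟨he₂, hD⟩,
        Finset.insert_subset_insert _ h₁, h₂.trans (Finset.subset_insert _ _), ?_, ?_, ?_⟩
      · rwa [Finset.insert_union, Finset.insert_sdiff_insert,
          Finset.sdiff_insert_of_notMem he]
      · intro i
        have := hr i
        rw [Finset.filter_insert]
        by_cases hi : e.1 = i
        · subst hi
          rw [Function.update_self] at this
          rw [if_pos rfl, Finset.card_insert_of_notMem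
            (fun h => he₁ (Finset.mem_filter.1 h).1)]
          omega
        · rw [Function.update_of_ne (fun h => hi (Sum.inl_injective h).symm)] at this
          rwa [if_neg hi]
      · intro j
        have := hc j
        rwa [Function.update_of_ne (by simp)] at this
    by_cases hcol : ∀ J, Sum.inr e.2 ∈ J → ν (cellsWithin J ∩ E ∪ B) < ∑ j ∈ J, x j
    · obtain ⟨hpos, h1⟩ := hdec _ hcol
      obtain ⟨D₁, D₂, hD, h₁, h₂, hν, hr, hc⟩ := IH B hEB.2 _ h1
      have he₁ : e ∉ D₁ := fun h => he (h₁ h)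
      have he₂ : e ∉ D₂ := fun h => he (h₂ h)
      refine ⟨D₁, insert e D₂, Finset.disjoint_insert_right.2 ⟨he₁, hD⟩,
        h₁.trans (Finset.subset_insert _ _), Finset.insert_subset_insert _ h₂, ?_, ?_, ?_⟩
      · rwa [Finset.union_insert, Finset.insert_sdiff_insert,
          Finset.sdiff_insert_of_notMem he]
      · intro i
        have := hr i
        rwa [Function.update_of_ne (by simp)] at this
      · intro j
        have := hc j
        rw [Finset.filter_insert]
        by_cases hj : e.2 = j
        · subst hj
          rw [Function.update_self] at this
          rw [if_pos rfl, Finset.card_insert_of_notMem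
            (fun h => he₂ (Finset.mem_filter.1 h).1)]
          omega
        · rw [Function.update_of_ne (fun h => hj (Sum.inr_injective h).symm)] at this
          rwa [if_neg hj]
    have hkeep : ∀ J, ν (cellsWithin J ∩ E ∪ insert e B) ≤ ∑ j ∈ J, x j := by
      push Not at hrow hcol
      obtain ⟨I₁, hi₁, hI₁⟩ := hrow
      obtain ⟨I₂, hi₂, hI₂⟩ := hcol
      intro J
      set K := I₁ ∪ I₂ with hK
      have heK : e ∈ cellsWithin (K ∪ J) := by
        rw [mem_cellsWithin, hK]
        simp [hi₁, hi₂]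
      have htight : ∑ j ∈ K, x j ≤ ν (cellsWithin K ∩ E ∪ B) := by
        have h1 := hsup (cellsWithin I₁ ∩ E ∪ B) (cellsWithin I₂ ∩ E ∪ B)
        have h2 : (cellsWithin I₁ ∩ E ∪ B) ∩ (cellsWithin I₂ ∩ E ∪ B) =
            cellsWithin (I₁ ∩ I₂) ∩ E ∪ B := by
          rw [cellsWithin_inter, ← Finset.inter_union_distrib_right,
            ← Finset.inter_inter_distrib_right]
        have h3 : (cellsWithin I₁ ∩ E ∪ B) ∪ (cellsWithin I₂ ∩ E ∪ B) ⊆ cellsWithin K ∩ E ∪ B :=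
          Finset.union_subset
            (Finset.union_subset_union_left (Finset.inter_subset_inter_right
              (cellsWithin_mono Finset.subset_union_left)))
            (Finset.union_subset_union_left (Finset.inter_subset_inter_right
              (cellsWithin_mono Finset.subset_union_right)))
        have h4 := hmono h3
        have h5 := (hsub (I₁ ∩ I₂)).trans (hx (I₁ ∩ I₂))
        have h6 := hsum I₁ I₂
        rw [h2] at h1
        rw [hK] at h4 ⊢
        omega
      have h1 := hsup (cellsWithin K ∩ E ∪ B) (cellsWithin J ∩ E ∪ insert e B)
      have h2 : (cellsWithin K ∩ E ∪ B) ∩ (cellsWithin J ∩ E ∪ insert e B) ⊆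
          cellsWithin (K ∩ J) ∩ E ∪ B := by
        intro a ha
        rw [cellsWithin_inter]
        simp only [Finset.mem_inter, Finset.mem_union, Finset.mem_insert] at ha ⊢
        by_cases hae : a = e
        · subst hae
          exact absurd ha.1 (by simp [he, hEB.1])
        · tauto
      have h3 : (cellsWithin K ∩ E ∪ B) ∪ (cellsWithin J ∩ E ∪ insert e B) ⊆
          cellsWithin (K ∪ J) ∩ insert e E ∪ B := by
        rw [hins' _ heK]
        intro a ha
        have hl := @cellsWithin_mono _ _ _ _ _ _ _ _ (Finset.subset_union_left (s₁ := K) (s₂ := J)) a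
        have hr := @cellsWithin_mono _ _ _ _ _ _ _ _ (Finset.subset_union_right (s₁ := K) (s₂ := J)) a
        simp only [Finset.mem_inter, Finset.mem_union, Finset.mem_insert] at ha ⊢
        tauto
      have h4 := hmono h2
      have h5 := hmono h3
      have h6 := hx (K ∪ J)
      have h7 := (hsub (K ∩ J)).trans (hx (K ∩ J))
      have h8 := hsum K J
      omega
    obtain ⟨D₁, D₂, hD, h₁, h₂, hν, hr, hc⟩ :=
      IH (insert e B) (Finset.disjoint_insert_right.2 ⟨he, hEB.2⟩) x hkeep
    refine ⟨D₁, D₂, hD, h₁.trans (Finset.subset_insert _ _), h₂.trans (Finset.subset_insert _ _),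
      ?_, hr, hc⟩
    rwa [Finset.insert_sdiff_of_notMem _ (fun h => (Finset.mem_union.1 h).elim
      (fun h => he (h₁ h)) (fun h => he (h₂ h))), Finset.insert_union, ← Finset.union_insert]

end Polymatroid

section Nullity

variable {α : Type*} (N : Matroid α)

/-- The nullity of a finite set of elements of a matroid. -/
noncomputable def finsetNullity (X : Finset α) : ℕ := X.card - (N.eRk X).toNat

lemma finsetNullity_add_eRk (X : Finset α) : (finsetNullity N X : ℕ∞) + N.eRk X = X.card := by
  have h1 : N.eRk X ≤ (X.card : ℕ∞) := by
    rw [← Set.encard_coe_eq_coe_finsetCard]; exact N.eRk_le_encard X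
  obtain ⟨r, hr⟩ := ENat.ne_top_iff_exists.1 (ne_top_of_le_ne_top (ENat.natCast_ne_top _) h1)
  rw [← hr, Nat.cast_le] at h1
  rw [finsetNullity, ← hr, ENat.toNat_natCast, ← Nat.cast_add, Nat.sub_add_cancel h1]

lemma exists_eRk_eq (X : Finset α) :
    ∃ r : ℕ, N.eRk X = r ∧ finsetNullity N X + r = X.card := by
  have h := finsetNullity_add_eRk N X
  have h1 : N.eRk X ≠ ⊤ := by
    intro h1
    rw [h1, add_top] at h
    exact ENat.natCast_ne_top _ h.symm
  obtain ⟨r, hr⟩ := ENat.ne_top_iff_exists.1 h1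
  refine ⟨r, hr.symm, ?_⟩
  rw [← hr] at h
  exact_mod_cast h

lemma finsetNullity_mono : Monotone (finsetNullity N) := by
  classical
  intro X Y hXY
  obtain ⟨r, hr, hX⟩ := exists_eRk_eq N X
  obtain ⟨s, hs, hY⟩ := exists_eRk_eq N Y
  have h1 : N.eRk Y ≤ N.eRk X + ((Y \ X).card : ℕ∞) := by
    rw [← Set.encard_coe_eq_coe_finsetCard]
    refine le_trans (N.eRk_mono ?_) (N.eRk_union_le_eRk_add_encard _ _)
    rw [← Finset.coe_union, Finset.union_sdiff_of_subset hXY]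
  rw [hr, hs] at h1
  have h2 : s ≤ r + (Y \ X).card := by exact_mod_cast h1
  have h3 := Finset.card_sdiff_add_card_eq_card hXY
  omega

lemma finsetNullity_supermodular [DecidableEq α] (X Y : Finset α) :
    finsetNullity N X + finsetNullity N Y ≤ finsetNullity N (X ∩ Y) + finsetNullity N (X ∪ Y) := by
  obtain ⟨r, hr, hX⟩ := exists_eRk_eq N X
  obtain ⟨s, hs, hY⟩ := exists_eRk_eq N Y
  obtain ⟨a, ha, hXY⟩ := exists_eRk_eq N (X ∩ Y)
  obtain ⟨b, hb, hXY'⟩ := exists_eRk_eq N (X ∪ Y)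
  have h1 := N.eRk_inter_add_eRk_union_le (X : Set α) Y
  rw [← Finset.coe_inter, ← Finset.coe_union, hr, hs, ha, hb] at h1
  have h2 : a + b ≤ r + s := by exact_mod_cast h1
  have h3 := Finset.card_union_add_card_inter X Y
  omega

lemma finsetNullity_eq_zero_iff {X : Finset α} : finsetNullity N X = 0 ↔ N.Indep X := by
  rw [N.indep_iff_eRk_eq_encard_of_finite X.finite_toSet, Set.encard_coe_eq_coe_finsetCard]
  obtain ⟨r, hr, hX⟩ := exists_eRk_eq N X
  rw [hr, Nat.cast_inj]
  omega

end Nullity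

section AlgebraicMatroid

lemma comap_matroid_indep_iff {k A α : Type*} [Field k] [CommRing A] [IsDomain A] [Algebra k A]
    (f : α → A) {X : Set α} :
    ((AlgebraicIndependent.matroid k A).comap f).Indep X ↔
      AlgebraicIndependent k (fun e : X => f e) := by
  rw [Matroid.comap_indep_iff, AlgebraicIndependent.matroid_indep_iff]
  have h : Function.Injective (fun e : X => f e) →
      (AlgebraicIndepOn k id (f '' X) ↔ AlgebraicIndependent k (fun e : X => f e)) := by
    intro hinj
    rw [← algebraicIndependent_subtype_range hinj, Set.image_eq_range]
    rfl
  constructor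
  · rintro ⟨h1, h2⟩
    exact (h (Set.injOn_iff_injective.1 h2)).1 h1
  · intro h1
    exact ⟨(h h1.injective).2 h1, Set.injOn_iff_injective.2 h1.injective⟩

/-- A family of at most `r` elements generating, up to algebraic closure, an independent family
of `r` elements is independent. -/
lemma AlgebraicIndependent.of_forall_isAlgebraic {k A ι κ : Type*} [Field k] [CommRing A]
    [IsDomain A] [Algebra k A] [Fintype ι] [Fintype κ] {x : ι → A} {y : κ → A}
    (hx : AlgebraicIndependent k x) (hcard : Fintype.card κ ≤ Fintype.card ι)
    (h : ∀ i, IsAlgebraic (Algebra.adjoin k (Set.range y)) (x i)) : AlgebraicIndependent k y := by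
  let M := AlgebraicIndependent.matroid k A
  have hxi : M.Indep (Set.range x) := hx.to_subtype_range
  have hcl : Set.range x ⊆ M.closure (Set.range y) := by
    rintro _ ⟨i, rfl⟩
    rw [AlgebraicIndependent.matroid_closure_eq]
    exact h i
  have h1 : (Fintype.card ι : ℕ∞) ≤ M.eRk (Set.range y) := by
    rw [← M.eRk_closure_eq (Set.range y)]
    refine le_trans (le_of_eq ?_) (M.eRk_mono hcl)
    rw [hxi.eRk_eq_encard, ← Set.image_univ, hx.injective.encard_image, Set.encard_univ,
      ENat.card_eq_coe_fintype_card]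
  have h2 : (Set.range y).encard ≤ (Fintype.card κ : ℕ∞) := by
    rw [← Set.image_univ, ← ENat.card_eq_coe_fintype_card, ← Set.encard_univ]
    exact Set.encard_image_le _ _
  have h3 : M.Indep (Set.range y) := by
    rw [M.indep_iff_eRk_eq_encard_of_finite (Set.finite_range y)]
    exact le_antisymm (M.eRk_le_encard _) (h2.trans ((Nat.cast_le.2 hcard).trans h1))
  have h4 : Function.Injective y := by
    rw [← Set.injOn_univ]
    refine Set.finite_univ.injOn_of_encard_image_eq (le_antisymm (Set.encard_image_le _ _) ?_)
    rw [Set.image_univ, Set.encard_univ, ENat.card_eq_coe_fintype_card]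
    exact (Nat.cast_le.2 hcard).trans (h1.trans (M.eRk_le_encard _))
  exact (algebraicIndependent_subtype_range h4).1 h3

end AlgebraicMatroid

section Extension

/-- Adjoining variables to an independent family preserves independence, even after perturbing
its members by polynomials without constant term. -/
lemma algebraicIndependent_sumElim_X {k F ι H : Type*} [Field k] [CommRing F] [Algebra k F]
    {x : ι → MvPolynomial H F} (hx : AlgebraicIndependent k (fun i => constantCoeff (x i))) :
    AlgebraicIndependent k (Sum.elim X x : H ⊕ ι → MvPolynomial H F) := by
  classical
  rw [algebraicIndependent_iff]
  intro f hf
  have hcomp : ∀ f, aeval (R := k) (Sum.elim X x : H ⊕ ι → MvPolynomial H F) f =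
      eval₂Hom (aeval x : MvPolynomial ι k →ₐ[k] MvPolynomial H F).toRingHom X
        (sumRingEquiv k H ι f) := by
    intro f
    induction f using MvPolynomial.induction_on with
    | C a => simp
    | add p q hp hq => rw [map_add, map_add, map_add, hp, hq]
    | mul_X p i hp =>
      rw [map_mul, map_mul, map_mul, hp]
      congr 1
      cases i <;> simp
  by_contra hf0
  set g := sumRingEquiv k H ι f with hg
  have hg0 : g ≠ 0 := (map_ne_zero_iff _ (sumRingEquiv k H ι).injective).2 hf0
  obtain ⟨α, hα⟩ := g.support.exists_minimal (by rwa [Finset.nonempty_iff_ne_empty, Ne,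
    MvPolynomial.support_eq_empty])
  have h0 : coeff α (eval₂Hom (aeval x : MvPolynomial ι k →ₐ[k] MvPolynomial H F).toRingHom X g)
      = 0 := by
    rw [hg, ← hcomp, hf, coeff_zero]
  rw [coe_eval₂Hom, eval₂_eq, coeff_sum, Finset.sum_eq_single α] at h0
  · rw [prod_X_pow_eq_monomial, coeff_mul_monomial', if_pos le_rfl, tsub_self, mul_one] at h0
    refine mem_support_iff.1 hα.1 (algebraicIndependent_iff.1 hx _ ?_)
    rw [← h0]
    exact (DFunLike.congr_fun (comp_aeval x
      (AlgHom.mk (constantCoeff (σ := H) (R := F)) (fun r => by simp) :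
        MvPolynomial H F →ₐ[k] F)) (coeff α g)).symm
  · intro β hβ hne
    rw [prod_X_pow_eq_monomial, coeff_mul_monomial', if_neg]
    exact fun hle => hne (le_antisymm hle (hα.2 hβ hle))
  · intro h
    exact absurd hα.1 h

lemma algebraicIndependent_algebraMap_fractionRing {k A ι : Type*} [Field k] [CommRing A]
    [IsDomain A] [Algebra k A] {x : ι → A} (hx : AlgebraicIndependent k x) :
    AlgebraicIndependent k (fun i => algebraMap A (FractionRing A) (x i)) :=
  hx.map' (f := IsScalarTower.toAlgHom k A (FractionRing A)) (IsFractionRing.injective A _)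

/-- Given elements `z e` which are independent away from the disjoint sets `D₁` and `D₂`, a
factorization `z e = t ^ d e * u e * v e` over an extension field such that `t`, the `u e` for
`e ∉ D₁` and the `v e` for `e ∉ D₂` are independent. -/
lemma exists_independent_factorization {k A C : Type} [Field k] [CommRing A] [IsDomain A]
    [Algebra k A] [Fintype C] [DecidableEq C] {z : C → A} (d : C → ℕ) {D₁ D₂ : Finset C}
    (hD : Disjoint D₁ D₂)
    (hz : AlgebraicIndependent k (fun e : {e // e ∉ D₁ ∪ D₂} => z e)) :
    ∃ (K : Type) (_ : Field K) (_ : Algebra k K) (φ : A →+* K) (t : K) (y : C ⊕ C → K),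
      (∀ e, φ (z e) = t ^ d e * y (Sum.inl e) * y (Sum.inr e)) ∧
      AlgebraicIndependent k (fun i : Option {m : C ⊕ C // m ∉ D₁.disjSum D₂} =>
        i.elim t (fun m => y m)) := by
  let F := FractionRing A
  let R := MvPolynomial (Option C) F
  let K := FractionRing R
  let φ : A →+* K := ((algebraMap R K).comp MvPolynomial.C).comp (algebraMap A F)
  let t : K := algebraMap R K (X none)
  let s : C → K := fun e => algebraMap R K (X (some e))
  have hs : ∀ o, algebraMap R K (X o) ≠ 0 := fun o =>
    (map_ne_zero_iff _ (IsFractionRing.injective R K)).2 (X_ne_zero o)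
  let y : C ⊕ C → K := Sum.elim
    (fun e => if e ∈ D₁ then φ (z e) / (t ^ d e * s e) else s e)
    (fun e => if e ∈ D₁ then s e else φ (z e) / (t ^ d e * s e))
  have hfac : ∀ e, φ (z e) = t ^ d e * y (Sum.inl e) * y (Sum.inr e) := by
    intro e
    have h1 : t ≠ 0 := hs none
    have h2 : s e ≠ 0 := hs (some e)
    have h3 : t ^ d e * s e ≠ 0 := mul_ne_zero (pow_ne_zero _ h1) h2
    have h4 : t ^ d e * s e * (φ (z e) / (t ^ d e * s e)) = φ (z e) := mul_div_cancel₀ _ h3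
    by_cases he : e ∈ D₁
    · simp only [y, Sum.elim_inl, Sum.elim_inr, he, if_true]
      rw [mul_right_comm, h4]
    · simp only [y, Sum.elim_inl, Sum.elim_inr, he, if_false]
      exact h4.symm
  refine ⟨K, inferInstance, inferInstance, φ, t, y, hfac, ?_⟩
  have h1 : AlgebraicIndependent k
      (Sum.elim X (fun e : {e // e ∉ D₁ ∪ D₂} => MvPolynomial.C (algebraMap A F (z e))) :
        Option C ⊕ {e // e ∉ D₁ ∪ D₂} → R) := by
    apply algebraicIndependent_sumElim_X
    simp only [constantCoeff_C]
    exact algebraicIndependent_algebraMap_fractionRing hz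
  have h2 := algebraicIndependent_algebraMap_fractionRing h1
  refine AlgebraicIndependent.of_forall_isAlgebraic h2 ?_ ?_
  · have h3 := Finset.card_union_of_disjoint hD
    have h4 := Finset.card_le_univ (D₁ ∪ D₂)
    simp only [Fintype.card_option, Fintype.card_sum, Fintype.card_subtype_compl,
      Fintype.card_coe, Finset.card_disjSum]
    omega
  · set G : Option {m : C ⊕ C // m ∉ D₁.disjSum D₂} → K := fun i => i.elim t (fun m => y m)
      with hG
    have hmem : ∀ a ∈ Algebra.adjoin k (Set.range G),
        IsAlgebraic (Algebra.adjoin k (Set.range G)) a := fun a ha =>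
      isAlgebraic_algebraMap (⟨a, ha⟩ : Algebra.adjoin k (Set.range G))
    have ht : t ∈ Algebra.adjoin k (Set.range G) := Algebra.subset_adjoin ⟨none, rfl⟩
    have hy : ∀ m, m ∉ D₁.disjSum D₂ → y m ∈ Algebra.adjoin k (Set.range G) := fun m hm =>
      Algebra.subset_adjoin ⟨some ⟨m, hm⟩, rfl⟩
    rintro ((_ | e) | ⟨e, he⟩)
    · exact hmem _ ht
    · by_cases he : e ∈ D₁
      · have h := hy (Sum.inr e) (by
          rw [Finset.inr_mem_disjSum]
          exact Finset.disjoint_left.1 hD he)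
        simp only [y, Sum.elim_inr, he, if_true] at h
        exact hmem _ h
      · have h := hy (Sum.inl e) (by rwa [Finset.inl_mem_disjSum])
        simp only [y, Sum.elim_inl, he, if_false] at h
        exact hmem _ h
    · rw [Finset.mem_union, not_or] at he
      refine hmem (φ (z e)) ?_
      rw [hfac]
      exact mul_mem (mul_mem (pow_mem ht _) (hy _ (by rw [Finset.inl_mem_disjSum]; exact he.1)))
        (hy _ (by rw [Finset.inr_mem_disjSum]; exact he.2))

/-- Generic perturbations of the members of an independent family are independent of each other
and of the coefficients of the perturbation. -/
lemma exists_generic_perturbation {k K : Type} [Field k] [Field K] [Algebra k K] {I J L : Type}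
    [Fintype J] (t : K) (y : L → K) (p : I → L) (line : I → J → L)
    (hy : AlgebraicIndependent k (fun i : Option I => i.elim t (fun m => y (p m)))) :
    ∃ (K' : Type) (_ : Field K') (_ : Algebra k K') (φ : K →+* K') (h : I → J → K'),
      AlgebraicIndependent k (fun i : Option (I × Option J) => i.elim (φ t) (fun m =>
        m.2.elim (φ (y (p m.1)) + ∑ j, h m.1 j * φ (y (line m.1 j))) (h m.1))) := by
  let R := MvPolynomial (I × J) K
  let ψ : R →+* FractionRing R := algebraMap R (FractionRing R)
  let x : Option I → R := fun i => i.elim (C t) (fun m =>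
    C (y (p m)) + ∑ j, X (m, j) * C (y (line m j)))
  have h1 : AlgebraicIndependent k (Sum.elim X x : (I × J) ⊕ Option I → R) := by
    apply algebraicIndependent_sumElim_X
    convert hy using 2 with i
    cases i <;> simp [x]
  have h2 := algebraicIndependent_algebraMap_fractionRing h1
  let g : Option (I × Option J) → (I × J) ⊕ Option I := fun i =>
    i.elim (Sum.inr none) (fun m => m.2.elim (Sum.inr (some m.1)) (fun j => Sum.inl (m.1, j)))
  have hg : Function.Injective g := by
    rintro (_ | ⟨i, _ | j⟩) (_ | ⟨i', _ | j'⟩) h <;> simp_all [g]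
  refine ⟨FractionRing R, inferInstance, inferInstance, ψ.comp C, fun i j => ψ (X (i, j)), ?_⟩
  have h3 := AlgebraicIndependent.comp h2 g hg
  have hfun : (fun i : Option (I × Option J) => i.elim ((ψ.comp C) t) (fun m =>
      m.2.elim ((ψ.comp C) (y (p m.1)) + ∑ j, ψ (X (m.1, j)) * (ψ.comp C) (y (line m.1 j)))
        (fun j => ψ (X (m.1, j))))) =
      (fun i => algebraMap R (FractionRing R) (Sum.elim X x i)) ∘ g := by
    funext i
    rcases i with (_ | ⟨i, _ | j⟩)
    · rfl
    · simp [g, x, ψ]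
    · rfl
  rw [← hfun] at h3
  exact h3

end Extension

section Specialization

open IsLocalRing

/-- An independent family in a field, one member of which is to be specialized to `0`, lies in a
valuation ring inducing this specialization, the other members staying generic. -/
lemma exists_valuationSubring_specialization {k K ι : Type*} [Field k] [Field K] [Algebra k K]
    {x : Option ι → K} (hx : AlgebraicIndependent k x) :
    ∃ (V : ValuationSubring K) (Φ : MvPolynomial (Option ι) k →+* V),
      (∀ p, (Φ p : K) = aeval x p) ∧
      ∀ p, residue V (Φ p) = 0 ↔
        aeval (fun i => i.elim 0 X : Option ι → MvPolynomial ι k) p = 0 := by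
  let f : MvPolynomial (Option ι) k →+* K := (aeval x : MvPolynomial (Option ι) k →ₐ[k] K).toRingHom
  have hf : Function.Injective f := hx
  let A := f.range
  let e : MvPolynomial (Option ι) k ≃+* A :=
    RingEquiv.ofBijective f.rangeRestrict
      ⟨fun a b h => hf (congrArg Subtype.val h), f.rangeRestrict_surjective⟩
  let g : MvPolynomial (Option ι) k →+* MvPolynomial ι k :=
    (aeval (fun i => i.elim 0 X : Option ι → MvPolynomial ι k)).toRingHom
  let P : Ideal A := RingHom.ker (g.comp e.symm.toRingHom)
  have hP : P.IsPrime := RingHom.ker_isPrime _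
  obtain ⟨V, hV⟩ := (LocalSubring.ofPrime A P).exists_le_valuationSubring
  obtain ⟨hle, hloc⟩ := LocalSubring.le_def.1 hV
  refine ⟨V, (Subring.inclusion ((LocalSubring.le_ofPrime A P).trans hle)).comp e.toRingHom,
    fun p => rfl, fun p => ?_⟩
  have h1 : (aeval (fun i => i.elim 0 X : Option ι → MvPolynomial ι k) p = 0) ↔ e p ∈ P := by
    change g p = 0 ↔ g (e.symm (e p)) = 0
    rw [RingEquiv.symm_apply_apply]
  rw [h1, residue_eq_zero_iff, ← not_iff_not, mem_maximalIdeal, mem_nonunits_iff, not_not,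
    ← Ideal.mem_primeCompl_iff,
    ← IsLocalization.AtPrime.isUnit_to_map_iff (LocalSubring.ofPrime A P).toSubring P (e p)]
  constructor
  · intro h
    exact hloc.map_nonunit (algebraMap A (LocalSubring.ofPrime A P).toSubring (e p)) h
  · intro h
    exact h.map (Subring.inclusion hle)

/-- A finite family in a valued field can be scaled to be integral with a unit entry. -/
lemma exists_mul_mem_valuationSubring {K J : Type*} [Field K] [Finite J] (V : ValuationSubring K)
    (z : J → K) (hz : ∃ j, z j ≠ 0) : ∃ α : K, (∀ j, α * z j ∈ V) ∧ ∃ j, α * z j = 1 := by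
  obtain ⟨j₀, hj₀⟩ := hz
  have : Nonempty J := ⟨j₀⟩
  obtain ⟨m, hm⟩ := Finite.exists_max (fun j => V.valuation (z j))
  have hm0 : z m ≠ 0 := by
    intro h
    have h1 := hm j₀
    rw [h, map_zero, le_zero_iff, map_eq_zero] at h1
    exact hj₀ h1
  refine ⟨(z m)⁻¹, fun j => ?_, m, inv_mul_cancel₀ hm0⟩
  rw [← ValuationSubring.valuation_le_one_iff, map_mul, map_inv₀]
  exact (inv_mul_le_one₀ (zero_lt_iff.2 ((map_ne_zero _).2 hm0))).2 (hm j)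

/-- If the entries of a vector `y` at the positions of `M`, after a generic perturbation, have
generic integral values, then `y` can be scaled to an integral vector with at most `|J| - |M|`
entries in the maximal ideal. -/
lemma exists_scaling {k K J : Type*} [Field k] [Field K] [Fintype J] [DecidableEq J]
    {V : ValuationSubring K} {M : Finset J}
    (Φ : MvPolynomial ({j // j ∈ M} × Option J) k →+* V) (hΦ : ∀ p, residue V (Φ p) = 0 → p = 0)
    (y : J → K)
    (hy : ∀ m : {j // j ∈ M}, (Φ (X (m, none)) : K) = y m + ∑ j, (Φ (X (m, some j)) : K) * y j) :
    ∃ (α : K) (u : J → V), (∀ j, (u j : K) = α * y j) ∧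
      ∃ Z : Finset J, (∀ j, j ∈ Z ↔ residue V (u j) = 0) ∧ Z.card + M.card ≤ Fintype.card J := by
  classical
  obtain ⟨α, hmem, j₀, hj₀⟩ := exists_mul_mem_valuationSubring V
    (fun i : Option J => i.elim 1 y) ⟨none, one_ne_zero⟩
  let w : Option J → V := fun i => ⟨α * i.elim 1 y, hmem i⟩
  let Z := Finset.univ.filter (fun j => residue V (w (some j)) = 0)
  have hZ : ∀ j, j ∈ Z ↔ residue V (w (some j)) = 0 := fun j => by simp [Z]
  refine ⟨α, fun j => w (some j), fun j => rfl, Z, hZ, ?_⟩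
  clear_value Z
  by_contra! hlt
  let NZ := {j // j ∉ Z}
  have hcard : Fintype.card (Option NZ) ≤ Fintype.card {j // j ∈ M} := by
    have h1 := Finset.card_le_univ Z
    simp only [Fintype.card_option, NZ, Fintype.card_subtype_compl, Fintype.card_coe]
    omega
  obtain ⟨c⟩ := Function.Embedding.nonempty_of_card_le hcard
  let Q : Matrix (Option NZ) (Option NZ) (MvPolynomial ({j // j ∈ M} × Option J) k) :=
    Matrix.of fun a b => b.elim (-X (c a, none))
      (fun j => (if (c a : J) = j then 1 else 0) + X (c a, some (j : J)))
  have hQ : Q.det ≠ 0 := by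
    let ev : ({j // j ∈ M} × Option J) → k := fun m => m.2.elim
      (if m.1 = c none then -1 else 0)
      (fun j => (if ∃ h : j ∉ Z, c (some ⟨j, h⟩) = m.1 then 1 else 0) -
        (if (m.1 : J) = j then 1 else 0))
    intro h
    have h1 : ((MvPolynomial.eval ev).mapMatrix Q) = 1 := by
      ext a b
      rw [RingHom.mapMatrix_apply, Matrix.map_apply, Matrix.one_apply]
      rcases b with (_ | ⟨j, hj⟩)
      · simp only [Q, ev, Matrix.of_apply, Option.elim, map_neg, eval_X, c.injective.eq_iff]
        split_ifs <;> simp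
      · simp only [Q, ev, Matrix.of_apply, Option.elim, map_add, eval_X]
        have h2 : (∃ h : j ∉ Z, c (some ⟨j, h⟩) = c a) ↔ a = some ⟨j, hj⟩ := by
          simp only [c.injective.eq_iff]
          exact ⟨fun ⟨_, h⟩ => h.symm, fun h => ⟨hj, h.symm⟩⟩
        rw [if_congr h2 rfl rfl]
        by_cases h3 : (c a : J) = j <;> simp [h3]
    have h2 := congrArg (MvPolynomial.eval ev) h
    rw [RingHom.map_det, h1, Matrix.det_one, map_zero] at h2
    exact one_ne_zero h2
  let ρ : MvPolynomial ({j // j ∈ M} × Option J) k →+* ResidueField V := (residue V).comp Φ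
  have hdet : (ρ.mapMatrix Q).det ≠ 0 := by
    rw [← RingHom.map_det]
    exact fun h => hQ (hΦ _ h)
  let wb : Option NZ → ResidueField V := fun b => residue V (w (b.map Subtype.val))
  have hmul : (ρ.mapMatrix Q).mulVec wb = 0 := by
    funext a
    have hV : w none * Φ (X (c a, none)) =
        w (some (c a : J)) + ∑ j, Φ (X (c a, some j)) * w (some j) := by
      apply Subtype.ext
      push_cast
      simp only [w, Option.elim, mul_one]
      rw [hy, mul_add, Finset.mul_sum]
      congr 1
      exact Finset.sum_congr rfl fun j _ => by ring
    have hr := congrArg (residue V) hV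
    rw [map_mul, map_add, map_sum] at hr
    have hsum : ∑ j, residue V (Φ (X (c a, some j)) * w (some j)) =
        ∑ j : NZ, ρ (X (c a, some (j : J))) * wb (some j) := by
      refine Eq.trans ?_ (Finset.sum_subtype (Finset.univ.filter (· ∉ Z)) (by simp)
        (fun j => ρ (X (c a, some j)) * residue V (w (some j))))
      rw [Finset.sum_filter]
      refine Finset.sum_congr rfl fun j _ => ?_
      by_cases h : j ∈ Z
      · rw [if_neg (not_not.2 h), map_mul, (hZ j).1 h, mul_zero]
      · rw [if_pos h, map_mul]
        rfl
    have hdelta : residue V (w (some (c a : J))) =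
        ∑ j : NZ, (if (c a : J) = j then 1 else 0) * wb (some j) := by
      simp only [ite_mul, one_mul, zero_mul]
      by_cases h : (c a : J) ∈ Z
      · rw [(hZ _).1 h, Finset.sum_eq_zero]
        intro j _
        rw [if_neg]
        rintro h'
        exact j.2 (h' ▸ h)
      · rw [Finset.sum_eq_single ⟨c a, h⟩]
        · rw [if_pos rfl]
          rfl
        · intro j _ hj
          rw [if_neg]
          exact fun h' => hj (Subtype.ext h'.symm)
        · simp
    rw [hsum, hdelta, ← Finset.sum_add_distrib] at hr
    rw [Matrix.mulVec, dotProduct, Fintype.sum_option, Pi.zero_apply]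
    simp only [RingHom.mapMatrix_apply, Matrix.map_apply, Q, Matrix.of_apply, Option.elim, map_neg,
      map_add, add_mul, apply_ite ρ, map_one, map_zero]
    rw [← hr]
    simp only [ρ, wb, RingHom.comp_apply, Option.map_none]
    ring
  have hzero := Matrix.eq_zero_of_mulVec_eq_zero hdet hmul
  have hw : ∀ i, residue V (w i) = 0 := by
    rintro (_ | j)
    · exact congrFun hzero none
    · by_cases h : j ∈ Z
      · exact (hZ j).1 h
      · exact congrFun hzero (some ⟨j, h⟩)
  have hone : w j₀ = 1 := Subtype.ext hj₀
  have := hw j₀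
  rw [hone, map_one] at this
  exact one_ne_zero this

/-- A matrix which factors through fewer coordinates than its size is singular. -/
lemma det_sum_mul_eq_zero {K ι α : Type*} [Field K] [Fintype ι] [DecidableEq ι] {s : Finset α}
    (hs : s.card < Fintype.card ι) (F : ι → α → K) (G : α → ι → K) :
    (Matrix.of fun i j => ∑ a ∈ s, F i a * G a j).det = 0 := by
  have h1 : (Matrix.of fun i j => ∑ a ∈ s, F i a * G a j) =
      (Matrix.of fun i (a : s) => F i a) * (Matrix.of fun (a : s) j => G a j) := by
    ext i j
    rw [Matrix.mul_apply, Matrix.of_apply, ← Finset.sum_coe_sort]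
    rfl
  by_contra h
  have h2 := Matrix.rank_of_isUnit _ ((Matrix.isUnit_iff_isUnit_det _).2 (isUnit_iff_ne_zero.2 h))
  rw [h1] at h2
  have h3 := Matrix.rank_mul_le_right (Matrix.of fun i (a : s) => F i a)
    (Matrix.of fun (a : s) j => G a j)
  have h4 := Matrix.rank_le_card_height (Matrix.of fun (a : s) j => G a j)
  rw [Fintype.card_coe] at h4
  omega

lemma sum_mul_lt_sum_comp_perm_mul {ι : Type*} [Fintype ι] {a b : ι → ℕ}
    (ha : Function.Injective a) (hab : ∀ i j, a i < a j → b j < b i) {σ : Equiv.Perm ι}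
    (hσ : σ ≠ 1) : ∑ i, a i * b i < ∑ i, a (σ i) * b i := by
  have hanti : Antivary a b := by
    intro i j h
    by_contra! h'
    exact absurd (hab _ _ h') (by omega)
  refine hanti.sum_mul_lt_sum_comp_perm_mul_iff.2 fun h => hσ ?_
  let _ : LinearOrder ι := LinearOrder.lift' a ha
  have hmono : StrictMono σ := by
    refine Monotone.strictMono_of_injective (fun i j hij => ?_) σ.injective
    rcases hij.eq_or_lt with rfl | hij
    · exact le_rfl
    · exact h (hab i j hij)
  have h2 := Subsingleton.elim (StrictMono.orderIsoOfSurjective σ hmono σ.surjective)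
    (OrderIso.refl ι)
  ext i
  exact congrArg (fun e : ι ≃o ι => e i) h2

/-- The diagonal term of the determinant of a matrix with entries `τ ^ (a i * b j) * W i j`, with
`a` and `b` strictly antivarying, is its leading term. -/
lemma prod_diag_eq_zero_of_det_eq_zero {R κ ι : Type*} [CommRing R] [IsDomain R] [CommRing κ]
    [Fintype ι] [DecidableEq ι] (f : R →+* κ) {τ : R} (hτ : τ ≠ 0) (hf : f τ = 0) {a b : ι → ℕ}
    (ha : Function.Injective a) (hab : ∀ i j, a i < a j → b j < b i) (W : Matrix ι ι R)
    (hdet : (Matrix.of fun i j => τ ^ (a i * b j) * W i j).det = 0) : ∏ i, f (W i i) = 0 := by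
  set E := ∑ i, a i * b i with hE
  have hterm : ∀ σ : Equiv.Perm ι, ∏ i, τ ^ (a (σ i) * b i) * W (σ i) i =
      τ ^ E * (τ ^ (∑ i, a (σ i) * b i - E) * ∏ i, W (σ i) i) := by
    intro σ
    rw [Finset.prod_mul_distrib, Finset.prod_pow_eq_pow_sum, ← mul_assoc, ← pow_add]
    congr 2
    by_cases hσ : σ = 1
    · subst hσ
      simp [hE]
    · have := sum_mul_lt_sum_comp_perm_mul ha hab hσ
      omega
  rw [Matrix.det_apply'] at hdet
  simp only [Matrix.of_apply, hterm] at hdet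
  simp only [mul_left_comm _ (τ ^ E), ← Finset.mul_sum] at hdet
  have h0 := (mul_eq_zero.1 hdet).resolve_left (pow_ne_zero _ hτ)
  have h1 := congrArg f h0
  rw [map_sum, map_zero, Finset.sum_eq_single 1] at h1
  · simpa [hE] using h1
  · intro σ _ hσ
    have := sum_mul_lt_sum_comp_perm_mul ha hab hσ
    rw [map_mul, map_mul, map_pow, hf, zero_pow (by omega), zero_mul, mul_zero]
  · simp

end Specialization

section Degeneration

open IsLocalRing

lemma card_filter_fst_eq {α β : Type*} [DecidableEq α] [DecidableEq β] [Fintype β]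
    (S : Finset (α × β)) (i : α) :
    (S.filter (fun e => e.1 = i)).card = (Finset.univ.filter (fun j => (i, j) ∈ S)).card := by
  refine (Finset.card_bij (fun j _ => (i, j)) ?_ ?_ ?_).symm
  · simp
  · simp
  · rintro ⟨a, b⟩ h
    obtain ⟨h1, rfl⟩ := Finset.mem_filter.1 h
    exact ⟨b, by simpa using h1, rfl⟩

lemma card_filter_snd_eq {α β : Type*} [DecidableEq α] [DecidableEq β] [Fintype α]
    (S : Finset (α × β)) (j : β) :
    (S.filter (fun e => e.2 = j)).card = (Finset.univ.filter (fun i => (i, j) ∈ S)).card := by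
  refine (Finset.card_bij (fun i _ => (i, j)) ?_ ?_ ?_).symm
  · simp
  · simp
  · rintro ⟨a, b⟩ h
    obtain ⟨h1, rfl⟩ := Finset.mem_filter.1 h
    exact ⟨a, by simpa using h1, rfl⟩

variable {n : ℕ}

/-- A row-and-column charging of the cells outside an independent set degenerates to a pair of sets
of cells which are no larger in each row resp. column, and whose complement obeys the rank
conditions of `w`. -/
lemma exists_chainBounded_compl (w : Equiv.Perm (Fin n)) {D₁ D₂ : Finset (Fin n × Fin n)}
    (hD : Disjoint D₁ D₂)
    (hz : AlgebraicIndependent ℚ (fun e : {e // e ∉ D₁ ∪ D₂} => cellEntry w e)) :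
    ∃ Z₁ Z₂ : Finset (Fin n × Fin n), ChainBounded w (Z₁ ∪ Z₂)ᶜ ∧
      (∀ i, (Z₁.filter (fun e => e.1 = i)).card ≤ (D₁.filter (fun e => e.1 = i)).card) ∧
      (∀ j, (Z₂.filter (fun e => e.2 = j)).card ≤ (D₂.filter (fun e => e.2 = j)).card) := by
  classical
  obtain ⟨K, _, _, φ, t, y, hfac, hy⟩ :=
    exists_independent_factorization (fun e : Fin n × Fin n => (e.1 : ℕ) * (e.2 : ℕ)) hD hz
  let line : {m // m ∉ D₁.disjSum D₂} → Fin n → (Fin n × Fin n) ⊕ (Fin n × Fin n) := fun m j =>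
    m.1.elim (fun e => Sum.inl (e.1, j)) (fun e => Sum.inr (j, e.2))
  obtain ⟨K', _, _, φ', h, hind⟩ := exists_generic_perturbation t y Subtype.val line hy
  obtain ⟨V, Φ, hΦ, hres⟩ := exists_valuationSubring_specialization hind
  have hline : ∀ l : Fin n → (Fin n × Fin n) ⊕ (Fin n × Fin n), Function.Injective l →
      (∀ j (hj : l j ∉ D₁.disjSum D₂), line ⟨l j, hj⟩ = l) →
      ∃ (α : K') (u : Fin n → V), (∀ j, (u j : K') = α * φ' (y (l j))) ∧
        ∃ Z : Finset (Fin n), (∀ j, j ∈ Z ↔ residue V (u j) = 0) ∧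
          Z.card ≤ (Finset.univ.filter (fun j => l j ∈ D₁.disjSum D₂)).card := by
    intro l hl hll
    let M := Finset.univ.filter (fun j => l j ∉ D₁.disjSum D₂)
    let κ : {j // j ∈ M} × Option (Fin n) → {m // m ∉ D₁.disjSum D₂} × Option (Fin n) :=
      fun x => (⟨l x.1, (Finset.mem_filter.1 x.1.2).2⟩, x.2)
    have hκ : Function.Injective κ := by
      rintro ⟨j, o⟩ ⟨j', o'⟩ hx
      simp only [κ, Prod.mk.injEq, Subtype.mk.injEq] at hx
      exact Prod.ext (Subtype.ext (hl hx.1)) hx.2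
    obtain ⟨α, u, hu, Z, hZ, hcard⟩ := exists_scaling (V := V) (M := M)
      (Φ.comp (rename (R := ℚ) (some ∘ κ)).toRingHom) (fun p hp => by
        have h1 := (hres _).1 hp
        rw [AlgHom.toRingHom_eq_coe, RingHom.coe_coe, aeval_rename] at h1
        refine rename_injective κ hκ ?_
        rw [← aeval_X_left_apply (rename κ p), aeval_rename, map_zero, ← h1]
        rfl)
      (fun j => φ' (y (l j))) (fun m => by
        simp only [RingHom.comp_apply, AlgHom.toRingHom_eq_coe, RingHom.coe_coe, rename_X, hΦ,
          aeval_X, κ, Function.comp_apply, Option.elim, hll])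
    refine ⟨α, u, hu, Z, hZ, ?_⟩
    have h1 := Finset.card_filter_add_card_filter_not (s := (Finset.univ : Finset (Fin n)))
      (fun j => l j ∈ D₁.disjSum D₂)
    rw [Finset.card_univ] at h1
    change _ + (Finset.univ.filter (fun j => l j ∉ D₁.disjSum D₂)).card ≤ _ at hcard
    omega
  have hrow := fun i : Fin n => hline (fun j => Sum.inl (i, j))
    (fun j j' hj => by simpa using hj) (fun j hj => rfl)
  have hcol := fun j : Fin n => hline (fun i => Sum.inr (i, j))
    (fun i i' hi => by simpa using hi) (fun i hi => rfl)
  choose α u hu Z₁ hZ₁ hcard₁ using hrow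
  choose β v hv Z₂ hZ₂ hcard₂ using hcol
  refine ⟨Finset.univ.filter (fun e => e.2 ∈ Z₁ e.1), Finset.univ.filter (fun e => e.1 ∈ Z₂ e.2),
    ?_, fun i => ?_, fun j => ?_⟩
  · intro p q A hA hchain hpq
    by_contra! hlt
    let a : A → ℕ := fun x => (x.1.1 : ℕ)
    let b : A → ℕ := fun x => (x.1.2 : ℕ)
    let τ : V := Φ (X none)
    have hτ : τ ≠ 0 := by
      intro h0
      refine hind.ne_zero none ?_
      have h1 := hΦ (X none)
      rw [aeval_X] at h1
      rw [← h1]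
      exact congrArg Subtype.val h0
    have hτres : residue V τ = 0 := (hres _).2 (by rw [aeval_X]; rfl)
    have hab : ∀ x y : A, x ≠ y → (a x < a y ∧ b y < b x) ∨ (a y < a x ∧ b x < b y) :=
      fun x y hxy => hchain x x.2 y y.2 (fun h => hxy (Subtype.ext h))
    have hdet : (Matrix.of fun x y : A => τ ^ (a x * b y) *
        (u x.1.1 y.1.2 * v y.1.2 x.1.1)).det = 0 := by
      apply V.subtype_injective
      rw [RingHom.map_det, map_zero]
      rw [← det_sum_mul_eq_zero (K := K') (ι := A) (s := cornerSet w p q)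
        (by rwa [Fintype.card_coe])
        (fun x c => α x.1.1 * if c ≤ x.1.1 then φ' (φ (X (Sum.inl (x.1.1, c)))) else 0)
        (fun c y => β y.1.2 * if w c ≤ y.1.2 then φ' (φ (X (Sum.inr (w c, y.1.2)))) else 0)]
      congr 1
      ext x z
      rw [RingHom.mapMatrix_apply, Matrix.map_apply, Matrix.of_apply, Matrix.of_apply]
      have h1 : φ' (φ (cellEntry w (x.1.1, z.1.2))) = φ' t ^ (a x * b z) *
          φ' (y (Sum.inl (x.1.1, z.1.2))) * φ' (y (Sum.inr (x.1.1, z.1.2))) := by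
        rw [hfac]
        simp only [map_mul, map_pow, a, b]
      rw [cellEntry, map_sum, map_sum] at h1
      have h2 : cornerSet w x.1.1 z.1.2 =
          (cornerSet w p q).filter (fun c => c ≤ x.1.1 ∧ w c ≤ z.1.2) := by
        ext c
        simp only [mem_cornerSet, Finset.mem_filter]
        exact ⟨fun hc => ⟨⟨hc.1.trans (hpq x x.2).1, hc.2.trans (hpq z z.2).2⟩, hc⟩,
          fun hc => hc.2⟩
      have h3 : V.subtype (τ ^ (a x * b z) * (u x.1.1 z.1.2 * v z.1.2 x.1.1)) =
          α x.1.1 * β z.1.2 * (φ' t ^ (a x * b z) *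
          φ' (y (Sum.inl (x.1.1, z.1.2))) * φ' (y (Sum.inr (x.1.1, z.1.2)))) := by
        rw [map_mul, map_mul, map_pow]
        change (τ : K') ^ _ * ((u _ _ : K') * (v _ _ : K')) = _
        rw [hu, hv, hΦ, aeval_X, Option.elim]
        ring
      rw [h3, ← h1, h2, Finset.sum_filter, Finset.mul_sum]
      refine Finset.sum_congr rfl fun c _ => ?_
      by_cases hc1 : c ≤ x.1.1 <;> by_cases hc2 : w c ≤ z.1.2 <;> simp [hc1, hc2]
      ring
    have hprod := prod_diag_eq_zero_of_det_eq_zero (residue V) hτ hτres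
      (fun x y hxy => by
        by_contra hne
        rcases hab x y hne with h | h <;> omega)
      (fun x y hxy => by
        have hne : x ≠ y := by rintro rfl; omega
        rcases hab x y hne with h | h <;> omega) _ hdet
    obtain ⟨x, _, hx⟩ := Finset.prod_eq_zero_iff.1 hprod
    have hxA := Finset.mem_compl.1 (hA x.2)
    rw [Finset.mem_union, Finset.mem_filter, Finset.mem_filter, hZ₁, hZ₂] at hxA
    rw [map_mul, mul_eq_zero] at hx
    rcases hx with hx | hx
    · exact hxA (Or.inl ⟨Finset.mem_univ _, hx⟩)
    · exact hxA (Or.inr ⟨Finset.mem_univ _, hx⟩)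
  · rw [card_filter_fst_eq, card_filter_fst_eq]
    simpa using hcard₁ i
  · rw [card_filter_snd_eq, card_filter_snd_eq]
    simpa using hcard₂ j

end Degeneration

section Support

variable {n : ℕ}

lemma cellExponent_inl (P A : Finset (Fin n × Fin n)) (i : Fin n) :
    cellExponent P A (Sum.inl i) = (A.filter (fun e => e.1 = i)).card := by
  simp [cellExponent, Finsupp.single_apply]

lemma cellExponent_inr (P A : Finset (Fin n × Fin n)) (j : Fin n) :
    cellExponent P A (Sum.inr j) = ((P \ A).filter (fun e => e.2 = j)).card := by
  simp [cellExponent, Finsupp.single_apply]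

lemma card_cellsWithin_inter_le_sum_cellExponent (P A : Finset (Fin n × Fin n))
    (J : Finset (Fin n ⊕ Fin n)) :
    (cellsWithin J ∩ P).card ≤ ∑ j ∈ J, cellExponent P A j := by
  have h1 : ∑ j ∈ J, cellExponent P A j =
      (A.filter (fun e => Sum.inl e.1 ∈ J)).card +
        ((P \ A).filter (fun e => Sum.inr e.2 ∈ J)).card := by
    simp only [cellExponent, Finsupp.add_apply, Finsupp.finsetSum_apply, Finset.sum_add_distrib,
      Finsupp.single_apply]
    rw [Finset.sum_comm, Finset.sum_comm (s := J) (t := P \ A)]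
    simp
  rw [h1]
  refine le_trans (Finset.card_le_card fun e he => ?_) (Finset.card_union_le _ _)
  rw [Finset.mem_inter, mem_cellsWithin] at he
  rw [Finset.mem_union, Finset.mem_filter, Finset.mem_filter, Finset.mem_sdiff]
  tauto

lemma finsetNullity_le_card_inter {α : Type*} [DecidableEq α] (N : Matroid α) (X P : Finset α)
    (h : N.Indep ((X \ P : Finset α) : Set α)) : finsetNullity N X ≤ (X ∩ P).card := by
  obtain ⟨r, hr, hX⟩ := exists_eRk_eq N X
  obtain ⟨s, hs, hXP⟩ := exists_eRk_eq N (X \ P)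
  rw [(finsetNullity_eq_zero_iff N).2 h] at hXP
  have h1 : N.eRk (X \ P : Finset α) ≤ N.eRk X := N.eRk_mono (by simp)
  rw [hr, hs, Nat.cast_le] at h1
  have := Finset.card_sdiff_add_card_inter X P
  omega

lemma exists_compl_indep_card_eq {α : Type*} [Fintype α] [DecidableEq α] (N : Matroid α) :
    ∃ D : Finset α, N.Indep ((Dᶜ : Finset α) : Set α) ∧ D.card = finsetNullity N Finset.univ := by
  classical
  obtain ⟨B, hB⟩ := N.exists_isBase
  refine ⟨B.toFinsetᶜ, by simpa using hB.indep, ?_⟩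
  obtain ⟨r, hr, hU⟩ := exists_eRk_eq N Finset.univ
  have h1 : N.eRk (Finset.univ : Finset α) = B.encard := by
    rw [Finset.coe_univ, N.eRk_univ_eq, ← hB.encard_eq_eRank]
  rw [hr, Set.encard_eq_coe_toFinset_card, Nat.cast_inj] at h1
  rw [Finset.card_compl, ← Finset.card_univ]
  omega

/-- The support of a double Schubert polynomial consists of the lattice points of the base
polytope of the supermodular function given by the nullity of the generic matrix Schubert
variety on rectangles. -/
theorem IsSchubertFamily.mem_support_iff {S : Equiv.Perm (Fin n) → MvPolynomial (Fin n ⊕ Fin n) ℤ}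
    (hS : IsSchubertFamily S) (w : Equiv.Perm (Fin n)) (m : (Fin n ⊕ Fin n) →₀ ℕ) :
    m ∈ (S w).support ↔
      (∀ J, finsetNullity ((AlgebraicIndependent.matroid ℚ (MvPolynomial (TriVar n) ℚ)).comap
        (cellEntry w)) (cellsWithin J) ≤ ∑ j ∈ J, m j) ∧
      ∑ j, m j = finsetNullity ((AlgebraicIndependent.matroid ℚ
        (MvPolynomial (TriVar n) ℚ)).comap (cellEntry w)) Finset.univ := by
  set N := (AlgebraicIndependent.matroid ℚ (MvPolynomial (TriVar n) ℚ)).comap (cellEntry w)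
    with hN
  obtain ⟨Ps, hPs, -, hind, hchain⟩ := hS.exists_expansion w
  have hindep : ∀ P : Finset (Fin n × Fin n), N.Indep ((Pᶜ : Finset _) : Set (Fin n × Fin n)) ↔
      AlgebraicIndependent ℚ (fun e : {e // e ∉ P} => cellEntry w e) := by
    intro P
    rw [hN, comap_matroid_indep_iff, Finset.coe_compl]
    rfl
  have hlower : ∀ P A : Finset (Fin n × Fin n), N.Indep ((Pᶜ : Finset _) : Set (Fin n × Fin n)) →
      ∀ J, finsetNullity N (cellsWithin J) ≤ ∑ j ∈ J, cellExponent P A j := by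
    intro P A hP J
    refine (finsetNullity_le_card_inter N _ P (hP.subset ?_)).trans
      (card_cellsWithin_inter_le_sum_cellExponent P A J)
    intro e he
    simp only [Finset.coe_sdiff, Set.mem_sdiff] at he
    simpa using he.2
  have hmem : ∀ m, m ∈ (S w).support ↔ ∃ P ∈ Ps, ∃ A ⊆ P, cellExponent P A = m := by
    intro m
    rw [hPs, mem_support_sum_cellProd]
  have hsuff : ∀ m : (Fin n ⊕ Fin n) →₀ ℕ,
      (∀ J, finsetNullity N (cellsWithin J) ≤ ∑ j ∈ J, m j) →
      ∑ j, m j = finsetNullity N Finset.univ → m ∈ (S w).support := by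
    intro m hm hsum
    obtain ⟨D₁, D₂, hD, -, -, hν, hr, hc⟩ := exists_charging (finsetNullity_mono N)
      (finsetNullity_supermodular N) Finset.univ ∅ (by simp) m (by simpa using hm)
    rw [Finset.union_empty, finsetNullity_eq_zero_iff, ← Finset.compl_eq_univ_sdiff,
      hindep] at hν
    obtain ⟨Z₁, Z₂, hZ, hZ₁, hZ₂⟩ := exists_chainBounded_compl w hD hν
    obtain ⟨P, hP, hdisj⟩ := hchain _ hZ
    rw [disjoint_compl_right_iff] at hdisj
    refine (hmem m).2 ⟨P, hP, P ∩ Z₁, Finset.inter_subset_left, ?_⟩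
    have hle : ∀ j, cellExponent P (P ∩ Z₁) j ≤ m j := by
      rintro (i | j)
      · rw [cellExponent_inl]
        exact (Finset.card_le_card (Finset.filter_subset_filter _ Finset.inter_subset_right)).trans
          ((hZ₁ i).trans (hr i))
      · rw [cellExponent_inr]
        refine (Finset.card_le_card (Finset.filter_subset_filter _ ?_)).trans
          ((hZ₂ j).trans (hc j))
        intro e he
        have := hdisj (Finset.mem_sdiff.1 he).1
        simp only [Finset.mem_sdiff, Finset.mem_inter, Finset.mem_union] at he this
        tauto
    have hge := hlower P (P ∩ Z₁) ((hindep P).2 (hind P hP)) Finset.univ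
    rw [cellsWithin_univ, ← hsum] at hge
    ext j
    exact (Finset.sum_eq_sum_iff_of_le fun j _ => hle j).1
      (le_antisymm (Finset.sum_le_sum fun j _ => hle j) hge) j (Finset.mem_univ j)
  refine ⟨fun h => ?_, fun h => hsuff m h.1 h.2⟩
  constructor
  · obtain ⟨P, hP, A, -, rfl⟩ := (hmem m).1 h
    exact hlower P A ((hindep P).2 (hind P hP))
  · obtain ⟨D, hD, hcard⟩ := exists_compl_indep_card_eq N
    have hdeg : ∑ j, cellExponent D D j = finsetNullity N Finset.univ := by
      rw [← Finsupp.degree_eq_sum, degree_cellExponent subset_rfl, hcard]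
    have hDS := hsuff _ (hlower D D hD) hdeg
    obtain ⟨d, hd⟩ := hS.isHomogeneous w
    rw [← hdeg, ← Finsupp.degree_eq_sum, ← Finsupp.degree_eq_sum]
    have h1 := hd (MvPolynomial.mem_support_iff.1 h)
    have h2 := hd (MvPolynomial.mem_support_iff.1 hDS)
    rw [Finsupp.degree_eq_weight_one]
    exact h1.trans h2.symm

end Support

/-- **Theorem A**: the support of any double Schubert polynomial `𝔖_π`
is a discrete polymatroid on `[2p]`. -/
theorem support_doubleSchubert_isDiscretePolymatroid
    (p : ℕ) (hp : 1 ≤ p)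
    (𝔖 : Equiv.Perm (Fin p) → MvPolynomial (Fin p ⊕ Fin p) ℤ)
    (h𝔖 : IsDoubleSchubertFamily p 𝔖) (π : Equiv.Perm (Fin p)) :
    IsDiscretePolymatroid
      ((fun m : (Fin p ⊕ Fin p) →₀ ℕ => (m : (Fin p ⊕ Fin p) → ℕ)) ''
        ((𝔖 π).support : Set ((Fin p ⊕ Fin p) →₀ ℕ))) := by
  set N := (AlgebraicIndependent.matroid ℚ (MvPolynomial (TriVar p) ℚ)).comap (cellEntry π⁻¹)
    with hN
  have hmem := h𝔖.isSchubertFamily.mem_support_iff π⁻¹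
  simp only [inv_inv] at hmem
  refine isDiscretePolymatroid_of_supermodular
    (c := fun J => finsetNullity N (cellsWithin J)) ?_ ?_ ?_ ?_
  · have h : cellsWithin (∅ : Finset (Fin p ⊕ Fin p)) = ∅ := by
      ext e
      simp
    simp only [h]
    rw [finsetNullity_eq_zero_iff]
    simp
  · exact fun I J h => finsetNullity_mono N (cellsWithin_mono h)
  · intro I J
    refine (finsetNullity_supermodular N _ _).trans ?_
    rw [← cellsWithin_inter]
    exact Nat.add_le_add_left (finsetNullity_mono N (Finset.union_subset
      (cellsWithin_mono Finset.subset_union_left)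
      (cellsWithin_mono Finset.subset_union_right))) _
  · intro x
    obtain ⟨m, rfl⟩ := Finsupp.equivFunOnFinite.surjective x
    rw [cellsWithin_univ]
    refine Iff.trans ?_ (hmem m)
    exact DFunLike.coe_injective.mem_set_image
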